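/- arXiv:0912.4713 — 2 statements merged into one kernel-verified Lean document; each statement's English description precedes it below -/
import Mathlib

section
/- Suppose Γ is a finite set and let (x,σ), with σ ∈ S_e ∩ S_d, be a forward complete trajectory of the switched system ẋ = f(x,σ). Then: (1) if (x,σ) satisfies Assumption (A3) and for every γ ∈ Γ either O_γ^b(f_γ,W_γ) = E_γ ∩ O_γ or O_γ^f(f_γ,W_γ) = E_γ ∩ O_γ, then there exists c ∈ ℝ such that x → ∩_{γ∈Γ} (E_γ ∩ V_γ⁻¹(c)); if in addition ∩_{γ∈Γ} (E_γ ∩ V_γ⁻¹(c)) is a discrete set for each c ∈ ℝ, then x(t) converges to some x_e ∈ ∩_{γ∈Γ} (E_γ ∩ O_γ); (2) if (x,σ) satisfies Assumption (A5) and for every γ ∈ Γ either O_γ^b(f_γ,W_γ) = E_γ ∩ O_γ or O_γ^f(f_γ,W_γ) = E_γ ∩ O_γ, then x → ∩_{γ∈Γ} (E_γ ∩ O_γ); if in addition ∩_{γ∈Γ} (E_γ ∩ O_γ) is a discrete set, then x(t) converges to some x_e ∈ ∩_{γ∈Γ} (E_γ ∩ O_γ). -/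
open Filter Topology MeasureTheory Set

noncomputable section

abbrev Eucl (n : ℕ) : Type := EuclideanSpace ℝ (Fin n)

/-- The set of discontinuity (switching) times of a signal. -/
def JumpTimes {Γ : Type*} [TopologicalSpace Γ] (σ : ℝ → Γ) : Set ℝ :=
  {t | ¬ ContinuousAt σ t}

/-- A switching signal: piecewise constant (finitely many discontinuities in every
compact interval, locally constant to the right and on a left punctured neighborhood
of every point) and continuous from the right. -/
structure IsSwitchingSignal {Γ : Type*} [TopologicalSpace Γ] (σ : ℝ → Γ) : Prop where
  locFinite : ∀ a b : ℝ, (JumpTimes σ ∩ Set.Icc a b).Finite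
  rightConst : ∀ t : ℝ, ∃ ε > (0:ℝ), ∀ s ∈ Set.Ico t (t + ε), σ s = σ t
  leftConst : ∀ t : ℝ, ∃ ε > (0:ℝ), ∀ s ∈ Set.Ioo (t - ε) t, ∀ s' ∈ Set.Ioo (t - ε) t, σ s = σ s'

/-- `SA Γ τD N₀` : switching signals with average dwell time `τD` and chatter bound `N₀`. -/
def SA (Γ : Type*) [TopologicalSpace Γ] (τD : ℝ) (N₀ : ℕ) : Set (ℝ → Γ) :=
  {σ | IsSwitchingSignal σ ∧ ∀ τ₁ τ₂ : ℝ, τ₁ < τ₂ →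
    ((JumpTimes σ ∩ Set.Ioo τ₁ τ₂).ncard : ℝ) ≤ (N₀ : ℝ) + (τ₂ - τ₁) / τD}

def SAall (Γ : Type*) [TopologicalSpace Γ] : Set (ℝ → Γ) :=
  ⋃ τD ∈ Set.Ioi (0 : ℝ), ⋃ N₀ : ℕ, SA Γ τD N₀

/-- Dwell-time signals. -/
def SD (Γ : Type*) [TopologicalSpace Γ] (τD : ℝ) : Set (ℝ → Γ) := SA Γ τD 1

def SDall (Γ : Type*) [TopologicalSpace Γ] : Set (ℝ → Γ) :=
  ⋃ τD ∈ Set.Ioi (0 : ℝ), SD Γ τD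

/-- First switching time strictly greater than `t` (`⊤` if none). -/
def tau1 {Γ : Type*} [TopologicalSpace Γ] (σ : ℝ → Γ) (t : ℝ) : EReal :=
  sInf (Real.toEReal '' (JumpTimes σ ∩ Set.Ioi t))

/-- The class `S^H` of switching signals compatible with the set-valued map `H`:
at each switching time the new value belongs to `H` of the left limit. -/
def SH {Γ : Type*} [TopologicalSpace Γ] (H : Γ → Set Γ) : Set (ℝ → Γ) :=
  {σ | ∀ t ∈ JumpTimes σ, ∀ γ' : Γ,
    Filter.Tendsto σ (nhdsWithin t (Set.Iio t)) (nhds γ') → σ t ∈ H γ'}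

/-- The "ergodic" class `S_e[T]`. -/
def SE (Γ : Type*) [TopologicalSpace Γ] (T : ℝ) : Set (ℝ → Γ) :=
  {σ | ∀ t₀ : ℝ, 0 ≤ t₀ → ∀ γ : Γ, ∃ t ∈ Set.Icc t₀ (t₀ + T), σ t = γ}

def SEall (Γ : Type*) [TopologicalSpace Γ] : Set (ℝ → Γ) :=
  ⋃ T ∈ Set.Ioi (0 : ℝ), SE Γ T

/-- Property P of a family of switching signals. -/
def HasPropertyP {Γ : Type*} [TopologicalSpace Γ] (S : Set (ℝ → Γ)) : Prop :=
  (∃ τD > (0 : ℝ), ∃ N₀ : ℕ, S ⊆ SA Γ τD N₀) ∧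
  (∀ σ ∈ S, ∀ s > (0 : ℝ), (fun t => σ (t + s)) ∈ S) ∧
  (∀ σseq : ℕ → ℝ → Γ, (∀ k, σseq k ∈ S) →
    ∃ σstar ∈ S, ∃ φ : ℕ → ℕ, StrictMono φ ∧
      ∀ᵐ t ∂(volume : Measure ℝ),
        Filter.Tendsto (fun l => σseq (φ l) t) Filter.atTop (nhds (σstar t)))

/-- A solution of `ẋ = g(x)` with values in `X`, on the set `I`. -/
def IsSolOn {n : ℕ} (g : Eucl n → Eucl n) (X : Set (Eucl n)) (φ : ℝ → Eucl n) (I : Set ℝ) : Prop :=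
  ContinuousOn φ I ∧ (∀ t ∈ I, φ t ∈ X) ∧
  ∀ t₀ ∈ I, ∀ t ∈ I,
    IntervalIntegrable (fun s => g (φ s)) volume t₀ t ∧
    φ t = φ t₀ + ∫ s in t₀..t, g (φ s)

/-- A trajectory of the switched system `ẋ = f(x,σ)` on the interval `I`. -/
structure IsTrajectory {n : ℕ} {Γ : Type*} [TopologicalSpace Γ]
    (f : Eucl n × Γ → Eucl n) (domf : Set (Eucl n × Γ))
    (x : ℝ → Eucl n) (σ : ℝ → Γ) (I : Set ℝ) : Prop where
  signal : IsSwitchingSignal σ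
  nonempty : I.Nonempty
  ordConn : I.OrdConnected
  cont : ContinuousOn x I
  mem : ∀ t ∈ I, (x t, σ t) ∈ domf
  intg : ∀ t₀ ∈ I, ∀ t ∈ I,
    IntervalIntegrable (fun s => f (x s, σ s)) volume t₀ t ∧
    x t = x t₀ + ∫ s in t₀..t, f (x s, σ s)

/-- Precompactness of a trajectory relative to `O`. -/
def PrecompactRel {n : ℕ} (x : ℝ → Eucl n) (I : Set ℝ) (O : Set (Eucl n)) : Prop :=
  ∃ B : Set (Eucl n), B ⊆ O ∧ IsCompact B ∧ ∀ t ∈ I, x t ∈ B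

/-- ω-limit set of `x` defined on `I`. -/
def OmegaLimit {n : ℕ} (x : ℝ → Eucl n) (I : Set ℝ) : Set (Eucl n) :=
  {ξ | ∃ s : ℕ → ℝ, StrictMono s ∧ (∀ k, s k ∈ I) ∧
    Filter.Tendsto s Filter.atTop Filter.atTop ∧
    Filter.Tendsto (fun k => x (s k)) Filter.atTop (nhds ξ)}

/-- The set `Ω♯(x,σ)`. -/
def OmegaSharp {n : ℕ} {Γ : Type*} [TopologicalSpace Γ] (x : ℝ → Eucl n) (σ : ℝ → Γ) :
    Set (Eucl n × Γ) :=
  {p | ∃ s : ℕ → ℝ, StrictMono s ∧ (∀ k, 0 ≤ s k) ∧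
    Filter.Tendsto s Filter.atTop Filter.atTop ∧
    (∃ r : EReal, 0 < r ∧
      Filter.Tendsto (fun k => tau1 σ (s k) - Real.toEReal (s k)) Filter.atTop (nhds r)) ∧
    Filter.Tendsto (fun k => x (s k)) Filter.atTop (nhds p.1) ∧
    Filter.Tendsto (fun k => σ (s k)) Filter.atTop (nhds p.2)}

/-- Weak invariance of `M` w.r.t. the family of complete trajectories `T`
(without the nonemptiness requirement). -/
def WeaklyInvariantCore {n : ℕ} {Γ : Type*} (T : Set ((ℝ → Eucl n) × (ℝ → Γ)))
    (M : Set (Eucl n × Γ)) : Prop :=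
  ∀ p ∈ M, ∃ xs ∈ T, xs.1 0 = p.1 ∧ xs.2 0 = p.2 ∧ ∀ t : ℝ, (xs.1 t, xs.2 t) ∈ M

/-- Weak invariance of a nonempty set `M` w.r.t. `T`. -/
def WeaklyInvariant {n : ℕ} {Γ : Type*} (T : Set ((ℝ → Eucl n) × (ℝ → Γ)))
    (M : Set (Eucl n × Γ)) : Prop :=
  M.Nonempty ∧ WeaklyInvariantCore T M

/-- Maximal weakly invariant subset of `S` w.r.t. `T`. -/
def MaxWeaklyInvariantIn {n : ℕ} {Γ : Type*} (T : Set ((ℝ → Eucl n) × (ℝ → Γ)))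
    (S : Set (Eucl n × Γ)) : Set (Eucl n × Γ) :=
  ⋃₀ {M | M ⊆ S ∧ WeaklyInvariantCore T M}

/-- All complete trajectories whose switching signal lies in `S`. -/
def TrajOf {n : ℕ} {Γ : Type*} [TopologicalSpace Γ] (f : Eucl n × Γ → Eucl n)
    (domf : Set (Eucl n × Γ)) (S : Set (ℝ → Γ)) : Set ((ℝ → Eucl n) × (ℝ → Γ)) :=
  {xs | IsTrajectory f domf xs.1 xs.2 Set.univ ∧ xs.2 ∈ S}

/-- `x → M` : convergence of `x(t)` to the set `M` as `t → +∞`. -/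
def ConvergesTo {n : ℕ} (x : ℝ → Eucl n) (M : Set (Eucl n)) : Prop :=
  Filter.Tendsto (fun t => Metric.infDist (x t) M) Filter.atTop (nhds 0)

def Oset {n : ℕ} {Γ : Type*} (domV : Set (Eucl n × Γ)) : Set (Eucl n) := Prod.fst '' domV

def Ogamma {n : ℕ} {Γ : Type*} (domV domf : Set (Eucl n × Γ)) (γ : Γ) : Set (Eucl n) :=
  {ξ | ξ ∈ Oset domV ∧ (ξ, γ) ∈ domf}

/-- The class 𝒱 of functions. -/
structure ClassVFun {n : ℕ} {Γ : Type*} (V : Eucl n × Γ → ℝ)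
    (domV domf : Set (Eucl n × Γ)) : Prop where
  openD : ∀ γ : Γ, IsOpen {ξ : Eucl n | (ξ, γ) ∈ domV}
  subD : ∀ γ : Γ, ∀ ξ ∈ Ogamma domV domf γ, (ξ, γ) ∈ domV
  diff : ∀ γ : Γ, ∀ ξ ∈ Ogamma domV domf γ, DifferentiableAt ℝ (fun ξ' => V (ξ', γ)) ξ

/-- The set `Z_V`. -/
def ZV {n : ℕ} {Γ : Type*} (f : Eucl n × Γ → Eucl n) (V : Eucl n × Γ → ℝ)
    (domV domf : Set (Eucl n × Γ)) : Set (Eucl n × Γ) :=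
  {p | p ∈ domf ∧ p.1 ∈ Oset domV ∧ fderiv ℝ (fun ξ' => V (ξ', p.2)) p.1 (f p) = 0}

/-- Assumption (A1). -/
structure AssumptionA1 {n : ℕ} {Γ : Type*} [TopologicalSpace Γ]
    (domf : Set (Eucl n × Γ)) (V : Eucl n × Γ → ℝ) (domV : Set (Eucl n × Γ))
    (x : ℝ → Eucl n) (σ : ℝ → Γ) (I : Set ℝ) : Prop where
  classV : ClassVFun V domV domf
  contV : ContinuousOn V (domf ∩ (Oset domV ×ˢ (Set.univ : Set Γ)))
  precompact : PrecompactRel x I (Oset domV)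
  nonincr : AntitoneOn (fun t => V (x t, σ t)) (Set.Ici 0)

/-- Assumption (A2) (for finite Γ). -/
structure AssumptionA2 {n : ℕ} {Γ : Type*} [TopologicalSpace Γ]
    (domf : Set (Eucl n × Γ)) (V : Eucl n × Γ → ℝ) (domV : Set (Eucl n × Γ))
    (x : ℝ → Eucl n) (σ : ℝ → Γ) (I : Set ℝ) : Prop where
  classV : ClassVFun V domV domf
  precompact : PrecompactRel x I (Oset domV)
  nonincr : ∀ γ : Γ, AntitoneOn (fun t => V (x t, σ t)) ({t | σ t = γ} ∩ Set.Ici 0)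

/-- The inequality `−∇V_γ(ξ)·f_γ(ξ) ≥ W_γ(ξ) ≥ 0` on each `O_γ`. -/
def Wineq {n : ℕ} {Γ : Type*} (f : Eucl n × Γ → Eucl n) (V W : Eucl n × Γ → ℝ)
    (domV domf : Set (Eucl n × Γ)) : Prop :=
  ∀ γ : Γ, ∀ ξ ∈ Ogamma domV domf γ,
    W (ξ, γ) ≤ -(fderiv ℝ (fun ξ' => V (ξ', γ)) ξ (f (ξ, γ))) ∧ 0 ≤ W (ξ, γ)

/-- Assumption (A4). -/
structure AssumptionA4 {n : ℕ} {Γ : Type*} [TopologicalSpace Γ] (f : Eucl n × Γ → Eucl n)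
    (domf : Set (Eucl n × Γ)) (V : Eucl n × Γ → ℝ) (domV : Set (Eucl n × Γ))
    (W : Eucl n × Γ → ℝ) (x : ℝ → Eucl n) (σ : ℝ → Γ) (I : Set ℝ) : Prop where
  classV : ClassVFun V domV domf
  boundedV : ∀ K : Set (Eucl n × Γ), K ⊆ domf ∩ (Oset domV ×ˢ (Set.univ : Set Γ)) →
    IsCompact K → ∃ M : ℝ, ∀ p ∈ K, |V p| ≤ M
  precompact : PrecompactRel x I (Oset domV)
  nonincr : AntitoneOn (fun t => V (x t, σ t)) (Set.Ici 0)
  wineq : Wineq f V W domV domf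
  contW : ContinuousOn W (domf ∩ (Oset domV ×ˢ (Set.univ : Set Γ)))

/-- The set `X^f(g,h,τ)` for finite `τ`. -/
def XFwd {n : ℕ} (X : Set (Eucl n)) (g : Eucl n → Eucl n) (h : Eucl n → ℝ) (τ : ℝ) :
    Set (Eucl n) :=
  {ξ | ∃ φ : ℝ → Eucl n, IsSolOn g X φ (Set.Icc 0 τ) ∧ φ 0 = ξ ∧
    ∀ t ∈ Set.Icc (0 : ℝ) τ, h (φ t) = 0}

/-- The set `X^b(g,h,τ)` for finite `τ`. -/
def XBwd {n : ℕ} (X : Set (Eucl n)) (g : Eucl n → Eucl n) (h : Eucl n → ℝ) (τ : ℝ) :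
    Set (Eucl n) :=
  {ξ | ∃ φ : ℝ → Eucl n, IsSolOn g X φ (Set.Icc (-τ) 0) ∧ φ 0 = ξ ∧
    ∀ t ∈ Set.Icc (-τ) (0 : ℝ), h (φ t) = 0}

/-- The set `X^f(g,h,∞)`. -/
def XFwdInf {n : ℕ} (X : Set (Eucl n)) (g : Eucl n → Eucl n) (h : Eucl n → ℝ) :
    Set (Eucl n) :=
  {ξ | ∃ φ : ℝ → Eucl n, IsSolOn g X φ (Set.Ici 0) ∧ φ 0 = ξ ∧
    ∀ t ∈ Set.Ici (0 : ℝ), h (φ t) = 0}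

/-- The set `X^b(g,h,∞)`. -/
def XBwdInf {n : ℕ} (X : Set (Eucl n)) (g : Eucl n → Eucl n) (h : Eucl n → ℝ) :
    Set (Eucl n) :=
  {ξ | ∃ φ : ℝ → Eucl n, IsSolOn g X φ (Set.Iic 0) ∧ φ 0 = ξ ∧
    ∀ t ∈ Set.Iic (0 : ℝ), h (φ t) = 0}

/-- `X^f(g,h) = ∪_{τ>0} X^f(g,h,τ)`. -/
def XFwdFin {n : ℕ} (X : Set (Eucl n)) (g : Eucl n → Eucl n) (h : Eucl n → ℝ) :
    Set (Eucl n) :=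
  ⋃ τ ∈ Set.Ioi (0 : ℝ), XFwd X g h τ

/-- `X^b(g,h) = ∪_{τ>0} X^b(g,h,τ)`. -/
def XBwdFin {n : ℕ} (X : Set (Eucl n)) (g : Eucl n → Eucl n) (h : Eucl n → ℝ) :
    Set (Eucl n) :=
  ⋃ τ ∈ Set.Ioi (0 : ℝ), XBwd X g h τ

/-- Weakly meagre functions on `[0,∞)`. -/
def WeaklyMeagre (y : ℝ → ℝ) : Prop :=
  ∀ I : ℕ → Set ℝ, (∀ k, (I k).Nonempty) → (∀ k, I k ⊆ Set.Ici 0) →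
    (∀ k, (I k).OrdConnected) → (Pairwise fun k l => Disjoint (I k) (I l)) →
    (∃ δ : ENNReal, 0 < δ ∧ ∀ k, δ ≤ volume (I k)) →
    Filter.Tendsto (fun k => sInf ((fun t => |y t|) '' I k)) Filter.atTop (nhds 0)

/-- Assumption (E0) : the origin is an equilibrium point of the switched system. -/
def AssumpE0 {n : ℕ} {Γ : Type*} (f : Eucl n × Γ → Eucl n) (domf : Set (Eucl n × Γ)) : Prop :=
  ∀ γ : Γ, ((0 : Eucl n), γ) ∈ domf → f (0, γ) = 0

/-- Assumption (U) : uniqueness of the solution of the IVP `ẋ = f_γ(x)`, `x(0)=0`. -/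
def AssumpU {n : ℕ} {Γ : Type*} (f : Eucl n × Γ → Eucl n) (domf : Set (Eucl n × Γ)) : Prop :=
  ∀ γ : Γ, ((0 : Eucl n), γ) ∈ domf →
    ∀ I : Set ℝ, I.OrdConnected → (0 : ℝ) ∈ I →
    ∀ φ ψ : ℝ → Eucl n,
      IsSolOn (fun ξ => f (ξ, γ)) {ξ | (ξ, γ) ∈ domf} φ I →
      IsSolOn (fun ξ => f (ξ, γ)) {ξ | (ξ, γ) ∈ domf} ψ I →
      φ 0 = 0 → ψ 0 = 0 → ∀ t ∈ I, φ t = ψ t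

/-- The set `E_γ` of equilibrium points of `f_γ`. -/
def Egamma {n : ℕ} {Γ : Type*} (f : Eucl n × Γ → Eucl n) (domf : Set (Eucl n × Γ)) (γ : Γ) :
    Set (Eucl n) :=
  {ξ | (ξ, γ) ∈ domf ∧ f (ξ, γ) = 0}

/-- Discrete subsets of `ℝⁿ`. -/
def IsDiscreteSet {n : ℕ} (S : Set (Eucl n)) : Prop :=
  ∀ ξ ∈ S, ∃ ε > (0 : ℝ), S ∩ Metric.ball ξ ε = {ξ}

/-- Class-K functions (on `[0,∞)`). -/
structure ClassK (α : ℝ → ℝ) : Prop where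
  cont : ContinuousOn α (Set.Ici 0)
  mono : StrictMonoOn α (Set.Ici 0)
  zero : α 0 = 0

/-- Class-K∞ functions. -/
structure ClassKInf (α : ℝ → ℝ) extends ClassK α : Prop where
  unbounded : Filter.Tendsto α Filter.atTop Filter.atTop

/-- Local uniform stability of a family of forward complete trajectories. -/
def FamilyLUS {n : ℕ} {Γ : Type*} (T : Set ((ℝ → Eucl n) × (ℝ → Γ))) : Prop :=
  ∃ r > (0 : ℝ), ∃ α : ℝ → ℝ, ClassK α ∧
    ∀ xs ∈ T, ∀ t₀ : ℝ, 0 ≤ t₀ → ‖xs.1 t₀‖ ≤ r → ∀ t : ℝ, t₀ ≤ t → ‖xs.1 t‖ ≤ α ‖xs.1 t₀‖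

/-- Global uniform stability. -/
def FamilyGUS {n : ℕ} {Γ : Type*} (T : Set ((ℝ → Eucl n) × (ℝ → Γ))) : Prop :=
  ∃ α : ℝ → ℝ, ClassKInf α ∧
    ∀ xs ∈ T, ∀ t₀ : ℝ, 0 ≤ t₀ → ∀ t : ℝ, t₀ ≤ t → ‖xs.1 t‖ ≤ α ‖xs.1 t₀‖

/-- Local asymptotic stability. -/
def FamilyLAS {n : ℕ} {Γ : Type*} (T : Set ((ℝ → Eucl n) × (ℝ → Γ))) : Prop :=
  FamilyLUS T ∧ ∃ η > (0 : ℝ), ∀ xs ∈ T, ‖xs.1 0‖ < η →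
    Filter.Tendsto xs.1 Filter.atTop (nhds 0)

/-- Global asymptotic stability. -/
def FamilyGAS {n : ℕ} {Γ : Type*} (T : Set ((ℝ → Eucl n) × (ℝ → Γ))) : Prop :=
  FamilyGUS T ∧ ∀ xs ∈ T, Filter.Tendsto xs.1 Filter.atTop (nhds 0)

/-- A weak Lyapunov pair `(V,W)` for the family `T`. -/
structure WeakLyapunovPair {n : ℕ} {Γ : Type*} [TopologicalSpace Γ]
    (f : Eucl n × Γ → Eucl n) (domf : Set (Eucl n × Γ)) (V : Eucl n × Γ → ℝ)
    (domV : Set (Eucl n × Γ)) (W : Eucl n × Γ → ℝ)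
    (T : Set ((ℝ → Eucl n) × (ℝ → Γ))) : Prop where
  classV : ClassVFun V domV domf
  zeroMem : (0 : Eucl n) ∈ Oset domV
  bounds : ∃ α₁ α₂ : ℝ → ℝ, ClassK α₁ ∧ ClassK α₂ ∧
    ∀ γ : Γ, ∀ ξ ∈ Ogamma domV domf γ, α₁ ‖ξ‖ ≤ V (ξ, γ) ∧ V (ξ, γ) ≤ α₂ ‖ξ‖
  wineq : Wineq f V W domV domf
  decreasing : ∀ xs ∈ T, ∀ a b : ℝ, 0 ≤ a → a ≤ b →
    (∀ t ∈ Set.Icc a b, xs.1 t ∈ Oset domV) →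
    AntitoneOn (fun t => V (xs.1 t, xs.2 t)) (Set.Icc a b)

/-- An F-weak Lyapunov pair `(V,W)` for the family `T`. -/
structure FWeakLyapunovPair {n : ℕ} {Γ : Type*} [TopologicalSpace Γ]
    (f : Eucl n × Γ → Eucl n) (domf : Set (Eucl n × Γ)) (V : Eucl n × Γ → ℝ)
    (domV : Set (Eucl n × Γ)) (W : Eucl n × Γ → ℝ)
    (T : Set ((ℝ → Eucl n) × (ℝ → Γ))) : Prop where
  classV : ClassVFun V domV domf
  zeroMem : (0 : Eucl n) ∈ Oset domV
  bounds : ∃ α₁ α₂ : ℝ → ℝ, ClassK α₁ ∧ ClassK α₂ ∧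
    ∀ γ : Γ, ∀ ξ ∈ Ogamma domV domf γ, α₁ ‖ξ‖ ≤ V (ξ, γ) ∧ V (ξ, γ) ≤ α₂ ‖ξ‖
  wineq : Wineq f V W domV domf
  decreasing : ∀ xs ∈ T, ∀ a b : ℝ, 0 ≤ a → a ≤ b →
    (∀ t ∈ Set.Icc a b, xs.1 t ∈ Oset domV) →
    ∀ γ : Γ, AntitoneOn (fun t => V (xs.1 t, γ)) (Set.Icc a b ∩ {t | xs.2 t = γ})

/-- `V` is radially unbounded : the class-K bounds may be chosen of class K∞. -/
def RadiallyUnbounded {n : ℕ} {Γ : Type*} (V : Eucl n × Γ → ℝ)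
    (domV domf : Set (Eucl n × Γ)) : Prop :=
  ∃ α₁ α₂ : ℝ → ℝ, ClassKInf α₁ ∧ ClassKInf α₂ ∧
    ∀ γ : Γ, ∀ ξ ∈ Ogamma domV domf γ, α₁ ‖ξ‖ ≤ V (ξ, γ) ∧ V (ξ, γ) ≤ α₂ ‖ξ‖

/-- Simple cycle `{γ_i}_{i=1}^m` of the set-valued map `H`. -/
def IsSimpleCycle {Γ : Type*} (H : Γ → Set Γ) (m : ℕ) (γs : ℕ → Γ) : Prop :=
  3 ≤ m ∧ γs 1 = γs m ∧ (∀ i, 1 ≤ i → i < m → γs (i + 1) ∈ H (γs i)) ∧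
  ∀ i j, 1 ≤ i → i < j → j ≤ m → γs i = γs j → i = 1 ∧ j = m

/-- A family of forward complete trajectories of the switched system. -/
def ForwardCompleteFamily {n : ℕ} {Γ : Type*} [TopologicalSpace Γ]
    (f : Eucl n × Γ → Eucl n) (domf : Set (Eucl n × Γ))
    (T : Set ((ℝ → Eucl n) × (ℝ → Γ))) : Prop :=
  ∀ xs ∈ T, ∃ I : Set ℝ, Set.Ici (0 : ℝ) ⊆ I ∧ IsTrajectory f domf xs.1 xs.2 I

/-- Condition (a) : `O_γ^f(f_γ,W_γ,∞) ∩ O_γ^b(f_γ,W_γ,∞) ⊆ {0}` for every `γ`. -/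
def CondA {n : ℕ} {Γ : Type*} (f : Eucl n × Γ → Eucl n)
    (domf domV : Set (Eucl n × Γ)) (W : Eucl n × Γ → ℝ) : Prop :=
  ∀ γ : Γ, XFwdInf (Ogamma domV domf γ) (fun ξ => f (ξ, γ)) (fun ξ => W (ξ, γ)) ∩
    XBwdInf (Ogamma domV domf γ) (fun ξ => f (ξ, γ)) (fun ξ => W (ξ, γ)) ⊆ {0}

/-- Condition (b) : `O_γ^b(f_γ,W_γ) ∩ O_{γ'}^f(f_{γ'},W_{γ'}) ⊆ {0}` for `γ ≠ γ'`. -/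
def CondB {n : ℕ} {Γ : Type*} (f : Eucl n × Γ → Eucl n)
    (domf domV : Set (Eucl n × Γ)) (W : Eucl n × Γ → ℝ) : Prop :=
  ∀ γ γ' : Γ, γ ≠ γ' →
    XBwdFin (Ogamma domV domf γ) (fun ξ => f (ξ, γ)) (fun ξ => W (ξ, γ)) ∩
    XFwdFin (Ogamma domV domf γ') (fun ξ => f (ξ, γ')) (fun ξ => W (ξ, γ')) ⊆ {0}

/-- Condition (b') : the variant of (b) involving the level sets of `V`. -/
def CondB' {n : ℕ} {Γ : Type*} (f : Eucl n × Γ → Eucl n) (V : Eucl n × Γ → ℝ)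
    (domf domV : Set (Eucl n × Γ)) (W : Eucl n × Γ → ℝ) : Prop :=
  ∀ γ γ' : Γ, γ ≠ γ' → ∀ c : ℝ,
    XBwdFin (Ogamma domV domf γ) (fun ξ => f (ξ, γ)) (fun ξ => W (ξ, γ)) ∩
    XFwdFin (Ogamma domV domf γ') (fun ξ => f (ξ, γ')) (fun ξ => W (ξ, γ')) ∩
    {ξ : Eucl n | V (ξ, γ) = c} ∩ {ξ : Eucl n | V (ξ, γ') = c} ⊆ {0}

/-- Condition (i) of the cycle theorems :
either all the forward infinite-horizon sets, or all the backward ones, reduce to `{0}`. -/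
def CondI {n : ℕ} {Γ : Type*} (f : Eucl n × Γ → Eucl n)
    (domf domV : Set (Eucl n × Γ)) (W : Eucl n × Γ → ℝ) : Prop :=
  (∀ γ : Γ, XFwdInf (Ogamma domV domf γ) (fun ξ => f (ξ, γ)) (fun ξ => W (ξ, γ)) ⊆ {0}) ∨
  (∀ γ : Γ, XBwdInf (Ogamma domV domf γ) (fun ξ => f (ξ, γ)) (fun ξ => W (ξ, γ)) ⊆ {0})

/-- Condition (ii) on simple cycles of `H`. -/
def CondCycle {n : ℕ} {Γ : Type*} (f : Eucl n × Γ → Eucl n)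
    (domf domV : Set (Eucl n × Γ)) (W : Eucl n × Γ → ℝ) (H : Γ → Set Γ) : Prop :=
  ∀ m : ℕ, ∀ γs : ℕ → Γ, IsSimpleCycle H m γs →
    ∃ j : ℕ, 1 ≤ j ∧ j < m ∧
      XBwdFin (Ogamma domV domf (γs j)) (fun ξ => f (ξ, γs j)) (fun ξ => W (ξ, γs j)) ∩
      XFwdFin (Ogamma domV domf (γs (j + 1))) (fun ξ => f (ξ, γs (j + 1)))
        (fun ξ => W (ξ, γs (j + 1))) ⊆ {0}

/-- Condition (iii) on simple cycles of `H`, involving the level sets of `V`. -/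
def CondCycle' {n : ℕ} {Γ : Type*} (f : Eucl n × Γ → Eucl n) (V : Eucl n × Γ → ℝ)
    (domf domV : Set (Eucl n × Γ)) (W : Eucl n × Γ → ℝ) (H : Γ → Set Γ) : Prop :=
  ∀ c : ℝ, ∀ m : ℕ, ∀ γs : ℕ → Γ, IsSimpleCycle H m γs →
    ∃ j : ℕ, 1 ≤ j ∧ j < m ∧
      XBwdFin (Ogamma domV domf (γs j)) (fun ξ => f (ξ, γs j)) (fun ξ => W (ξ, γs j)) ∩
      XFwdFin (Ogamma domV domf (γs (j + 1))) (fun ξ => f (ξ, γs (j + 1)))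
        (fun ξ => W (ξ, γs (j + 1))) ∩
      {ξ : Eucl n | V (ξ, γs j) = c} ∩ {ξ : Eucl n | V (ξ, γs (j + 1)) = c} ⊆ {0}

/-- For every `γ`, `O_γ^b(f_γ,W_γ) = E_γ ∩ O_γ` or `O_γ^f(f_γ,W_γ) = E_γ ∩ O_γ`. -/
def CondEquilObs {n : ℕ} {Γ : Type*} (f : Eucl n × Γ → Eucl n)
    (domf domV : Set (Eucl n × Γ)) (W : Eucl n × Γ → ℝ) : Prop :=
  ∀ γ : Γ,
    XBwdFin (Ogamma domV domf γ) (fun ξ => f (ξ, γ)) (fun ξ => W (ξ, γ)) =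
      Egamma f domf γ ∩ Ogamma domV domf γ ∨
    XFwdFin (Ogamma domV domf γ) (fun ξ => f (ξ, γ)) (fun ξ => W (ξ, γ)) =
      Egamma f domf γ ∩ Ogamma domV domf γ

end

noncomputable section
lemma aux_final {n : ℕ} (x : ℝ → Eucl n) (hx : ContinuousOn x (Ici 0)) (B : Set (Eucl n))
    (hB : IsCompact B) (hxB : ∀ t, 0 ≤ t → x t ∈ B) (M : Set (Eucl n))
    (hM : ∀ (s : ℕ → ℝ) (ξ : Eucl n), Tendsto s atTop atTop →
      Tendsto (fun k => x (s k)) atTop (𝓝 ξ) → ξ ∈ M) :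
    ConvergesTo x M ∧ (IsDiscreteSet M → ∃ xe ∈ M, Tendsto x atTop (𝓝 xe)) := by
  have hsub : ∀ s : ℕ → ℝ, Tendsto s atTop atTop → ∃ ξ ∈ M, ∃ φ : ℕ → ℕ, StrictMono φ ∧
      Tendsto (fun k => x (s (φ k))) atTop (𝓝 ξ) := by
    intro s hs
    have hev : ∃ᶠ k in atTop, x (s k) ∈ B :=
      ((hs.eventually_ge_atTop 0).mono fun k hk => hxB _ hk).frequently
    obtain ⟨ξ, -, φ, hφ, hlim⟩ := hB.tendsto_subseq' hev
    exact ⟨ξ, hM _ ξ (hs.comp hφ.tendsto_atTop) hlim, φ, hφ, hlim⟩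
  constructor
  · unfold ConvergesTo
    rw [Metric.tendsto_nhds]
    intro ε hε
    by_contra hcon
    obtain ⟨s, hs, hs2⟩ := exists_seq_forall_of_frequently (not_eventually.1 hcon)
    obtain ⟨ξ, hξ, φ, hφ, hlim⟩ := hsub s hs
    obtain ⟨k, hk⟩ := ((Metric.tendsto_nhds.1 hlim) ε hε).exists
    apply hs2 (φ k)
    rw [Real.dist_eq, sub_zero, abs_of_nonneg Metric.infDist_nonneg]
    exact (Metric.infDist_le_dist_of_mem hξ).trans_lt hk
  · intro hD
    obtain ⟨ξ, hξ, φ, hφ, hlim⟩ := hsub (fun k => (k : ℝ)) tendsto_natCast_atTop_atTop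
    refine ⟨ξ, hξ, ?_⟩
    obtain ⟨ε, hε, hball⟩ := hD ξ hξ
    rw [Metric.tendsto_nhds]
    intro δ hδ
    by_contra hcon
    rw [not_eventually] at hcon
    set r := min δ (ε / 2) with hr
    have hr0 : 0 < r := lt_min hδ (by linarith)
    have hfreq : ∃ᶠ t in atTop, dist (x t) ξ = r := by
      rw [frequently_atTop]
      intro a
      obtain ⟨k, hk1, hk2⟩ := (((Metric.tendsto_nhds.1 hlim) r hr0).and
        ((tendsto_natCast_atTop_atTop.comp hφ.tendsto_atTop).eventually_ge_atTop
          (max a 0))).exists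
      have hk2' : max a 0 ≤ ((φ k : ℕ) : ℝ) := hk2
      obtain ⟨t, ht1, ht2⟩ := (frequently_atTop.1 hcon) ((φ k : ℕ) : ℝ)
      have hc : ContinuousOn (fun t => dist (x t) ξ) (Icc ((φ k : ℕ) : ℝ) t) :=
        (continuous_id.dist continuous_const).comp_continuousOn
          (hx.mono (fun u (hu : u ∈ Icc ((φ k : ℕ) : ℝ) t) =>
          ((le_max_right a 0).trans hk2').trans hu.1))
      have hmem : r ∈ Icc (dist (x ((φ k : ℕ) : ℝ)) ξ) (dist (x t) ξ) :=
        ⟨hk1.le, (min_le_left _ _).trans (not_lt.1 ht2)⟩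
      obtain ⟨u, hu, hu2⟩ := intermediate_value_Icc ht1 hc hmem
      exact ⟨u, ((le_max_left a 0).trans hk2').trans hu.1, hu2⟩
    obtain ⟨s, hs, hs2⟩ := exists_seq_forall_of_frequently hfreq
    obtain ⟨η, hη, φ', hφ', hlim'⟩ := hsub s hs
    have h1 : Tendsto (fun k => dist (x (s (φ' k))) ξ) atTop (𝓝 (dist η ξ)) :=
      hlim'.dist tendsto_const_nhds
    have h2 : dist η ξ = r := by
      refine tendsto_nhds_unique h1 ?_
      simp only [hs2]
      exact tendsto_const_nhds
    have h3 : η ∈ M ∩ Metric.ball ξ ε := by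
      refine ⟨hη, ?_⟩
      rw [Metric.mem_ball, h2]
      have := min_le_right δ (ε / 2)
      linarith
    rw [hball] at h3
    rw [mem_singleton_iff.1 h3, dist_self] at h2
    linarith

lemma aux_antitone (v : ℝ → ℝ) (S : Set ℝ) (hv : AntitoneOn v S) (hS : S.Nonempty)
    (hb : BddBelow (v '' S)) : ∃ c, Tendsto v (atTop ⊓ 𝓟 S) (𝓝 c) := by
  refine ⟨sInf (v '' S), ?_⟩
  rw [Metric.tendsto_nhds]
  intro ε hε
  obtain ⟨_, ⟨t₀, ht₀, rfl⟩, h⟩ := exists_lt_of_csInf_lt (hS.image v)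
    (lt_add_of_pos_right (sInf (v '' S)) hε)
  rw [eventually_inf_principal]
  filter_upwards [eventually_ge_atTop t₀] with t ht htS
  have h1 := csInf_le hb (mem_image_of_mem v htS)
  have h2 := hv ht₀ htS ht
  rw [Real.dist_eq, abs_lt]
  constructor <;> linarith

lemma aux_const {Γ : Type*} [MetricSpace Γ] [Finite Γ] (σ : ℝ → Γ) (hσ : IsSwitchingSignal σ)
    (a b : ℝ) (hab : a ≤ b) (h : ∀ t ∈ Ioc a b, t ∉ JumpTimes σ) :
    ∀ t ∈ Icc a b, ∀ s ∈ Icc a b, σ t = σ s := by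
  have hc : ContinuousOn σ (Icc a b) := by
    intro t ht
    rcases eq_or_lt_of_le ht.1 with rfl | hlt
    · obtain ⟨ε, hε, hr⟩ := hσ.rightConst a
      have : σ =ᶠ[𝓝[Icc a b] a] fun _ => σ a := by
        have h1 : Iio (a + ε) ∈ 𝓝[Icc a b] a :=
          mem_nhdsWithin_of_mem_nhds (Iio_mem_nhds (by linarith))
        filter_upwards [h1, self_mem_nhdsWithin] with s hs hs2
        exact hr s ⟨hs2.1, hs⟩
      exact (continuousWithinAt_const (b := σ a)).congr_of_eventuallyEq this rfl
    · exact (not_not.1 (h t ⟨hlt, ht.2⟩)).continuousWithinAt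
  intro t ht s hs
  exact isPreconnected_Icc.constant hc ht hs

lemma aux_dwell {Γ : Type*} [MetricSpace Γ] [Finite Γ] (σ : ℝ → Γ) (τD : ℝ) (hτ : 0 < τD)
    (hσ : σ ∈ SD Γ τD) (t : ℝ) :
    (∀ s ∈ Icc (t - τD / 3) t, σ s = σ t) ∨ (∀ s ∈ Icc t (t + τD / 3), σ s = σ t) := by
  obtain ⟨hsw, hcard⟩ := hσ
  by_cases h1 : ∀ s ∈ Ioc (t - τD / 3) t, s ∉ JumpTimes σ
  · left
    intro s hs
    exact aux_const σ hsw _ _ (by linarith) h1 s hs t ⟨by linarith, le_rfl⟩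
  right
  by_cases h2 : ∀ s ∈ Ioc t (t + τD / 3), s ∉ JumpTimes σ
  · intro s hs
    exact aux_const σ hsw _ _ (by linarith) h2 s hs t ⟨le_rfl, by linarith⟩
  exfalso
  push Not at h1 h2
  obtain ⟨p, hp, hpJ⟩ := h1
  obtain ⟨q, hq, hqJ⟩ := h2
  have hb := hcard (t - τD / 3) (t + τD / 2) (by linarith)
  have hfin : (JumpTimes σ ∩ Ioo (t - τD / 3) (t + τD / 2)).Finite :=
    (hsw.locFinite (t - τD / 3) (t + τD / 2)).subset
      (inter_subset_inter_right _ Ioo_subset_Icc_self)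
  have hlt : 1 < (JumpTimes σ ∩ Ioo (t - τD / 3) (t + τD / 2)).ncard := by
    rw [Set.one_lt_ncard hfin]
    exact ⟨p, ⟨hpJ, hp.1, by linarith [hp.2]⟩, q, ⟨hqJ, by linarith [hq.1], by linarith [hq.2]⟩,
      by have := hp.2; have := hq.1; intro h; linarith⟩
  have h2 : (2 : ℝ) ≤ ((JumpTimes σ ∩ Ioo (t - τD / 3) (t + τD / 2)).ncard : ℝ) := by
    exact_mod_cast hlt
  have h3 : (t + τD / 2 - (t - τD / 3)) / τD = 5 / 6 := by
    field_simp; ring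
  rw [h3] at hb
  push_cast at hb
  linarith

lemma aux_limit {n : ℕ} {Γ : Type*} [MetricSpace Γ] [Finite Γ]
    (f : Eucl n × Γ → Eucl n) (domf : Set (Eucl n × Γ))
    (hdomf : IsClosed domf) (hf : ContinuousOn f domf)
    (x : ℝ → Eucl n) (σ : ℝ → Γ) (Ix : Set ℝ)
    (htraj : IsTrajectory f domf x σ Ix) (hfc : Set.Ici (0 : ℝ) ⊆ Ix)
    (V : Eucl n × Γ → ℝ) (domV : Set (Eucl n × Γ)) (W : Eucl n × Γ → ℝ)
    (hV : ClassVFun V domV domf) (hW : Wineq f V W domV domf)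
    (hE : CondEquilObs f domf domV W)
    (B : Set (Eucl n)) (hBO : B ⊆ Oset domV) (hB : IsCompact B) (hxB : ∀ t, 0 ≤ t → x t ∈ B)
    (L : ℝ) (hL0 : 0 ≤ L) (hL : ∀ t, 0 ≤ t → ‖f (x t, σ t)‖ ≤ L)
    (hLip : ∀ s t, 0 ≤ s → 0 ≤ t → dist (x s) (x t) ≤ L * dist s t)
    (γ : Γ) (c : ℝ)
    (hc : Tendsto (fun t => V (x t, σ t)) (atTop ⊓ 𝓟 {t | σ t = γ}) (𝓝 c))
    (a : ℕ → ℝ) (ha : Tendsto a atTop atTop) (ha0 : ∀ k, 0 ≤ a k) (τ : ℝ) (hτ : 0 < τ)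
    (hγ : ∀ k, ∀ s ∈ Icc (a k) (a k + τ), σ s = γ) :
    ∃ φ : ℕ → ℕ, StrictMono φ ∧ ∀ s ∈ Icc 0 τ,
      Tendsto (fun k => f (x (a (φ k) + s), γ)) atTop (𝓝 0) := by
  have hxc : ContinuousOn x (Ici 0) := htraj.cont.mono hfc
  have hshift : ∀ k, Continuous fun s : Icc (0 : ℝ) τ => x (a k + s) := by
    intro k
    refine hxc.comp_continuous (by fun_prop) ?_
    intro s
    have := ha0 k
    have := s.2.1
    simp only [mem_Ici]
    linarith
  let y : ℕ → BoundedContinuousFunction (Icc (0 : ℝ) τ) (Eucl n) := fun k =>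
    BoundedContinuousFunction.mkOfCompact ⟨fun s : Icc (0 : ℝ) τ => x (a k + s), hshift k⟩
  let A : Set (BoundedContinuousFunction (Icc (0 : ℝ) τ) (Eucl n)) :=
    {g | (∀ s, g s ∈ B) ∧ ∀ s t, dist (g s) (g t) ≤ L * dist s t}
  have heval : ∀ s : Icc (0 : ℝ) τ, Continuous
      fun g : BoundedContinuousFunction (Icc (0 : ℝ) τ) (Eucl n) => g s :=
    fun s => continuous_eval_const s
  have hAclosed : IsClosed A := by
    have : A = (⋂ s, {g | g s ∈ B}) ∩ ⋂ s, ⋂ t, {g | dist (g s) (g t) ≤ L * dist s t} := by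
      ext g; simp only [A, mem_setOf_eq, mem_inter_iff, mem_iInter]
    rw [this]
    refine (isClosed_iInter fun s => ?_).inter (isClosed_iInter fun s => isClosed_iInter fun t => ?_)
    · exact hB.isClosed.preimage (heval s)
    · exact isClosed_le ((heval s).dist (heval t)) continuous_const
  have hAcomp : IsCompact A := by
    refine BoundedContinuousFunction.arzela_ascoli₂ B hB A hAclosed (fun g s hg => hg.1 s) ?_
    refine Metric.equicontinuous_of_continuity_modulus (fun r => L * r) ?_ _ ?_
    · have : Tendsto (fun r : ℝ => L * r) (𝓝 0) (𝓝 (L * 0)) := tendsto_id.const_mul L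
      simpa using this
    · intro s t g
      exact g.2.2 s t
  have hyA : ∀ k, y k ∈ A := by
    intro k
    have h0 := ha0 k
    refine ⟨fun s => hxB _ (by have := s.2.1; linarith), fun s t => ?_⟩
    have := hLip (a k + s) (a k + t) (by have := s.2.1; linarith) (by have := t.2.1; linarith)
    simpa [y, Subtype.dist_eq] using this
  obtain ⟨g, hgA, φ, hφ, hlim⟩ := hAcomp.tendsto_subseq hyA
  refine ⟨φ, hφ, ?_⟩
  let ψ : ℝ → Eucl n := fun s => g (projIcc 0 τ hτ.le s)
  have hψc : Continuous ψ := g.continuous.comp continuous_projIcc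
  have hpt : ∀ s ∈ Icc (0 : ℝ) τ, Tendsto (fun k => x (a (φ k) + s)) atTop (𝓝 (ψ s)) := by
    intro s hs
    have h := ((heval ⟨s, hs⟩).tendsto g).comp hlim
    simpa [ψ, projIcc_of_mem hτ.le hs, y, Function.comp_def] using h
  have hxdom : ∀ k, ∀ s ∈ Icc (0 : ℝ) τ, (x (a k + s), γ) ∈ domf := by
    intro k s hs
    have h0 := ha0 k
    have h1 := htraj.mem (a k + s) (hfc (by have := hs.1; simp only [mem_Ici]; linarith))
    rwa [hγ k (a k + s) ⟨by linarith [hs.1], by linarith [hs.2]⟩] at h1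
  have hψdom' : ∀ s ∈ Icc (0 : ℝ) τ, (ψ s, γ) ∈ domf := by
    intro s hs
    refine hdomf.mem_of_tendsto ((hpt s hs).prodMk_nhds (tendsto_const_nhds (x := γ))) ?_
    exact Eventually.of_forall fun k => hxdom _ s hs
  have hψproj : ∀ s, ψ s = ψ (projIcc 0 τ hτ.le s) := by
    intro s; simp [ψ]
  have hψdom : ∀ s, (ψ s, γ) ∈ domf := by
    intro s
    rw [hψproj s]
    exact hψdom' _ (projIcc 0 τ hτ.le s).2
  have hψB : ∀ s, ψ s ∈ B := fun s => hgA.1 _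
  have hψO : ∀ s, ψ s ∈ Ogamma domV domf γ := fun s => ⟨hBO (hψB s), hψdom s⟩
  have hfψ : Continuous fun r => f (ψ r, γ) :=
    hf.comp_continuous (hψc.prodMk continuous_const) hψdom
  have hflim : ∀ s ∈ Icc (0 : ℝ) τ,
      Tendsto (fun k => f (x (a (φ k) + s), γ)) atTop (𝓝 (f (ψ s, γ))) := by
    intro s hs
    have h1 : Tendsto (fun k => (x (a (φ k) + s), γ)) atTop (𝓝[domf] (ψ s, γ)) := by
      rw [tendsto_nhdsWithin_iff]
      exact ⟨(hpt s hs).prodMk_nhds tendsto_const_nhds,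
        Eventually.of_forall fun k => hxdom _ s hs⟩
    exact (hf _ (hψdom s)).tendsto.comp h1
  have hint : ∀ s ∈ Icc (0 : ℝ) τ, ∀ t ∈ Icc (0 : ℝ) τ, ψ t = ψ s + ∫ r in s..t, f (ψ r, γ) := by
    intro s hs t ht
    have hsub : uIcc s t ⊆ Icc 0 τ := uIcc_subset_Icc hs ht
    have hk : ∀ k, x (a k + t) = x (a k + s) + ∫ r in s..t, f (x (a k + r), γ) := by
      intro k
      have h0 := ha0 k
      have h1 := (htraj.intg (a k + s) (hfc (by have := hs.1; simp only [mem_Ici]; linarith))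
        (a k + t) (hfc (by have := ht.1; simp only [mem_Ici]; linarith))).2
      rw [h1, ← intervalIntegral.integral_comp_add_left (fun r => f (x r, σ r)) (a k)]
      congr 1
      apply intervalIntegral.integral_congr
      intro r hr
      have hr' := hsub hr
      simp only
      rw [hγ k (a k + r) ⟨by linarith [hr'.1], by linarith [hr'.2]⟩]
    have hI : Tendsto (fun k => ∫ r in s..t, f (x (a (φ k) + r), γ)) atTop
        (𝓝 (∫ r in s..t, f (ψ r, γ))) := by
      refine intervalIntegral.tendsto_integral_filter_of_dominated_convergence (fun _ => L) ?_ ?_ ?_ ?_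
      · refine Eventually.of_forall fun k => ?_
        have h1 : ContinuousOn (fun r => f (x (a (φ k) + r), γ)) (Icc 0 τ) := by
          refine hf.comp (ContinuousOn.prodMk ?_ continuousOn_const) (fun r hr => hxdom _ r hr)
          refine hxc.comp (by fun_prop) ?_
          intro r hr
          have := ha0 (φ k)
          have := hr.1
          simp only [mem_Ici]
          linarith
        exact (h1.mono (uIoc_subset_uIcc.trans hsub)).aestronglyMeasurable measurableSet_uIoc
      · refine Eventually.of_forall fun k => Eventually.of_forall fun r hr => ?_
        have hr' := hsub (uIoc_subset_uIcc hr)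
        have h0 := ha0 (φ k)
        have := hL (a (φ k) + r) (by linarith [hr'.1])
        rwa [hγ _ (a (φ k) + r) ⟨by linarith [hr'.1], by linarith [hr'.2]⟩] at this
      · exact intervalIntegrable_const
      · exact Eventually.of_forall fun r hr => hflim r (hsub (uIoc_subset_uIcc hr))
    refine tendsto_nhds_unique (hpt t ht) ?_
    simp only [hk]
    exact (hpt s hs).add hI
  have hVψ : ∀ s ∈ Icc (0 : ℝ) τ, V (ψ s, γ) = c := by
    intro s hs
    have h1 : Tendsto (fun k => V (x (a (φ k) + s), γ)) atTop (𝓝 (V (ψ s, γ))) :=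
      ((hV.diff γ _ (hψO s)).continuousAt.tendsto).comp (hpt s hs)
    refine tendsto_nhds_unique h1 ?_
    have hσs : ∀ k, σ (a (φ k) + s) = γ := fun k =>
      hγ _ _ ⟨by linarith [hs.1], by linarith [hs.2]⟩
    have h2 : Tendsto (fun k => a (φ k) + s) atTop (atTop ⊓ 𝓟 {t | σ t = γ}) := by
      rw [tendsto_inf, tendsto_principal]
      exact ⟨tendsto_atTop_add_const_right _ _ (ha.comp hφ.tendsto_atTop),
        Eventually.of_forall hσs⟩
    have h3 := hc.comp h2
    simpa [Function.comp_def, hσs] using h3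
  have hWψ : ∀ s ∈ Ioo (0 : ℝ) τ, W (ψ s, γ) = 0 := by
    intro s hs
    have hd0 : HasDerivAt (fun t => ψ 0 + ∫ r in (0:ℝ)..t, f (ψ r, γ)) (f (ψ s, γ)) s :=
      (hfψ.integral_hasStrictDerivAt 0 s).hasDerivAt.const_add _
    have hd : HasDerivAt ψ (f (ψ s, γ)) s := by
      refine hd0.congr_of_eventuallyEq ?_
      filter_upwards [Ioo_mem_nhds hs.1 hs.2] with t ht
      exact hint 0 ⟨le_rfl, hτ.le⟩ t ⟨ht.1.le, ht.2.le⟩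
    have hd1 := (hV.diff γ _ (hψO s)).hasFDerivAt.comp_hasDerivAt s hd
    have hd2 : HasDerivAt ((fun ξ' => V (ξ', γ)) ∘ ψ) 0 s := by
      refine (hasDerivAt_const s c).congr_of_eventuallyEq ?_
      filter_upwards [Ioo_mem_nhds hs.1 hs.2] with t ht
      exact hVψ t ⟨ht.1.le, ht.2.le⟩
    have h0 := hd1.unique hd2
    obtain ⟨h1, h2⟩ := hW γ _ (hψO s)
    rw [h0] at h1
    linarith
  have hsol : ∀ s : ℝ, ∀ I : Set ℝ, (∀ u ∈ I, s + u ∈ Icc 0 τ) →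
      IsSolOn (fun ξ => f (ξ, γ)) (Ogamma domV domf γ) (fun u => ψ (s + u)) I := by
    intro s I hI
    refine ⟨by fun_prop, fun t _ => hψO _, fun t₀ ht₀ t ht => ⟨?_, ?_⟩⟩
    · exact (hfψ.comp (continuous_const.add continuous_id)).intervalIntegrable _ _
    · rw [intervalIntegral.integral_comp_add_left (fun r => f (ψ r, γ)) s]
      exact hint _ (hI _ ht₀) _ (hI _ ht)
  have hEψ : ∀ s ∈ Ioo (0 : ℝ) τ, f (ψ s, γ) = 0 := by
    intro s hs
    rcases hE γ with h | h
    · have : ψ s ∈ XBwdFin (Ogamma domV domf γ) (fun ξ => f (ξ, γ)) (fun ξ => W (ξ, γ)) := by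
        refine mem_iUnion₂.2 ⟨s / 2, half_pos hs.1, fun u => ψ (s + u), ?_, by simp, ?_⟩
        · exact hsol s _ fun u hu => ⟨by linarith [hu.1, hs.1], by linarith [hu.2, hs.2]⟩
        · exact fun u hu => hWψ _ ⟨by linarith [hu.1, hs.1], by linarith [hu.2, hs.2]⟩
      rw [h] at this
      exact this.1.2
    · have : ψ s ∈ XFwdFin (Ogamma domV domf γ) (fun ξ => f (ξ, γ)) (fun ξ => W (ξ, γ)) := by
        refine mem_iUnion₂.2 ⟨(τ - s) / 2, half_pos (sub_pos.2 hs.2), fun u => ψ (s + u), ?_,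
          by simp, ?_⟩
        · exact hsol s _ fun u hu => ⟨by linarith [hu.1, hs.1], by linarith [hu.2, hs.2]⟩
        · exact fun u hu => hWψ _ ⟨by linarith [hu.1, hs.1], by linarith [hu.2, hs.2]⟩
      rw [h] at this
      exact this.1.2
  have hEψ' : ∀ s ∈ Icc (0 : ℝ) τ, f (ψ s, γ) = 0 := by
    have hcl : IsClosed {s | f (ψ s, γ) = 0} := isClosed_eq hfψ continuous_const
    have : closure (Ioo (0 : ℝ) τ) ⊆ {s | f (ψ s, γ) = 0} := closure_minimal hEψ hcl
    rw [closure_Ioo hτ.ne] at this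
    exact this
  intro s hs
  have := hflim s hs
  rwa [hEψ' s hs] at this

lemma aux_main {n : ℕ} {Γ : Type*} [MetricSpace Γ] [Finite Γ]
    (f : Eucl n × Γ → Eucl n) (domf : Set (Eucl n × Γ))
    (hdomf : IsClosed domf) (hf : ContinuousOn f domf)
    (x : ℝ → Eucl n) (σ : ℝ → Γ) (Ix : Set ℝ)
    (htraj : IsTrajectory f domf x σ Ix) (hfc : Set.Ici (0 : ℝ) ⊆ Ix)
    (hσ : σ ∈ SEall Γ ∩ SDall Γ)
    (V : Eucl n × Γ → ℝ) (domV : Set (Eucl n × Γ)) (W : Eucl n × Γ → ℝ)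
    (hV : ClassVFun V domV domf) (hW : Wineq f V W domV domf)
    (hE : CondEquilObs f domf domV W)
    (B : Set (Eucl n)) (hBO : B ⊆ Oset domV) (hB : IsCompact B) (hxB : ∀ t, 0 ≤ t → x t ∈ B)
    (c : Γ → ℝ)
    (hc : ∀ γ, Tendsto (fun t => V (x t, σ t)) (atTop ⊓ 𝓟 {t | σ t = γ}) (𝓝 (c γ)))
    (s : ℕ → ℝ) (ξ : Eucl n) (hs : Tendsto s atTop atTop)
    (hξ : Tendsto (fun k => x (s k)) atTop (𝓝 ξ)) (γ : Γ) :
    ξ ∈ Egamma f domf γ ∩ Ogamma domV domf γ ∧ V (ξ, γ) = c γ := by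
  obtain ⟨hσe, hσd⟩ := hσ
  obtain ⟨T, hT, hTe⟩ := mem_iUnion₂.1 hσe
  obtain ⟨τD, hτD, hτd⟩ := mem_iUnion₂.1 hσd
  have hT : 0 < T := hT
  have hτD : 0 < τD := hτD
  have hK : IsCompact (domf ∩ (B ×ˢ (univ : Set Γ))) :=
    (hB.prod isCompact_univ).inter_left hdomf
  obtain ⟨L', hL'⟩ := hK.exists_bound_of_continuousOn (hf.mono inter_subset_left)
  set L := max L' 0 with hLdef
  have hL0 : 0 ≤ L := le_max_right _ _
  have hL : ∀ t, 0 ≤ t → ‖f (x t, σ t)‖ ≤ L := fun t ht =>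
    (hL' _ ⟨htraj.mem t (hfc ht), hxB t ht, mem_univ _⟩).trans (le_max_left _ _)
  have hLip0 : ∀ C u t, 0 ≤ u → u ≤ t → (∀ r ∈ Icc u t, ‖f (x r, σ r)‖ ≤ C) →
      dist (x u) (x t) ≤ C * (t - u) := by
    intro C u t hu hut hb
    have h1 := (htraj.intg u (hfc hu) t (hfc (hu.trans hut))).2
    rw [dist_comm, dist_eq_norm, h1, add_sub_cancel_left]
    have h2 := intervalIntegral.norm_integral_le_of_norm_le_const (a := u) (b := t) (C := C)
      (f := fun r => f (x r, σ r)) (fun r hr => by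
        rw [uIoc_of_le hut] at hr
        exact hb r ⟨hr.1.le, hr.2⟩)
    rwa [abs_of_nonneg (sub_nonneg.2 hut)] at h2
  have hLip : ∀ u t, 0 ≤ u → 0 ≤ t → dist (x u) (x t) ≤ L * dist u t := by
    intro u t hu ht
    rcases le_total u t with h | h
    · have := hLip0 L u t hu h fun r hr => hL r (hu.trans hr.1)
      rwa [dist_comm u t, Real.dist_eq, abs_of_nonneg (sub_nonneg.2 h)]
    · have := hLip0 L t u ht h fun r hr => hL r (ht.trans hr.1)
      rwa [dist_comm (x u), Real.dist_eq, abs_of_nonneg (sub_nonneg.2 h)]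
  have hτ3 : 0 < τD / 3 := by positivity
  -- the velocity tends to zero
  have hzero : Tendsto (fun t => f (x t, σ t)) atTop (𝓝 0) := by
    rw [Metric.tendsto_nhds]
    intro ε hε
    by_contra hcon
    rw [not_eventually] at hcon
    have hfr : ∃ᶠ t in atTop, ∃ γ : Γ, ∃ b : Bool, (τD ≤ t ∧ ¬ dist (f (x t, σ t)) 0 < ε) ∧
        σ t = γ ∧ (if b then (∀ s ∈ Icc (t - τD / 3) t, σ s = σ t)
          else (∀ s ∈ Icc t (t + τD / 3), σ s = σ t)) := by
      refine (hcon.and_eventually (eventually_ge_atTop τD)).mono ?_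
      rintro t ⟨h1, h2⟩
      rcases aux_dwell σ τD hτD hτd t with h | h
      · exact ⟨σ t, true, ⟨h2, h1⟩, rfl, by simpa using h⟩
      · exact ⟨σ t, false, ⟨h2, h1⟩, rfl, by simpa using h⟩
    rw [frequently_exists] at hfr
    obtain ⟨γ', hfr⟩ := hfr
    rw [frequently_exists] at hfr
    obtain ⟨b, hfr⟩ := hfr
    obtain ⟨p, hp, hp2⟩ := exists_seq_forall_of_frequently hfr
    have key : ∀ (a : ℕ → ℝ) (r : ℝ), r ∈ Icc 0 (τD / 3) → (∀ k, p k = a k + r) →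
        (∀ k, ∀ s ∈ Icc (a k) (a k + τD / 3), σ s = γ') → False := by
      intro a r hr hpa hcst
      have ha0 : ∀ k, 0 ≤ a k := by
        intro k
        have h1 := hpa k
        have h2 := (hp2 k).1.1
        linarith [hr.2]
      have ha : Tendsto a atTop atTop := by
        have : a = fun k => p k + (-r) := by
          funext k; rw [hpa k]; ring
        rw [this]
        exact tendsto_atTop_add_const_right _ _ hp
      obtain ⟨φ, hφ, hl⟩ := aux_limit f domf hdomf hf x σ Ix htraj hfc V domV W hV hW hE B hBO hB
        hxB L hL0 hL hLip γ' (c γ') (hc γ') a ha ha0 (τD / 3) hτ3 hcst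
      obtain ⟨k, hk⟩ := ((Metric.tendsto_nhds.1 (hl r hr)) ε hε).exists
      have h3 := (hp2 (φ k)).1.2
      rw [(hp2 (φ k)).2.1, hpa] at h3
      exact h3 hk
    cases b with
    | true =>
      refine key (fun k => p k - τD / 3) (τD / 3) ⟨hτ3.le, le_rfl⟩ (fun k => by ring) ?_
      intro k s hs
      rw [← (hp2 k).2.1]
      have h4 := (hp2 k).2.2
      simp only [if_true] at h4
      exact h4 s ⟨hs.1, by simpa using hs.2⟩
    | false =>
      refine key p 0 ⟨le_rfl, hτ3.le⟩ (fun k => by ring) ?_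
      intro k s hs
      rw [← (hp2 k).2.1]
      have h4 := (hp2 k).2.2
      simp only [Bool.false_eq_true, if_false] at h4
      exact h4 s hs
  -- choose nearby times where the mode is `γ`
  have hch : ∀ k, ∃ t ∈ Icc (max (s k) 0) (max (s k) 0 + T), σ t = γ := fun k =>
    hTe _ (le_max_right _ _) γ
  choose u hu hσu using hch
  have hu0 : ∀ k, 0 ≤ u k := fun k => (le_max_right _ _).trans (hu k).1
  have hsu : ∀ k, s k ≤ u k := fun k => (le_max_left _ _).trans (hu k).1
  have hut : Tendsto u atTop atTop := tendsto_atTop_mono hsu hs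
  have hdist : Tendsto (fun k => dist (x (u k)) (x (s k))) atTop (𝓝 0) := by
    rw [Metric.tendsto_nhds]
    intro ε hε
    have hε2 : 0 < ε / (2 * T) := by positivity
    obtain ⟨t₀, ht₀⟩ := eventually_atTop.1 ((Metric.tendsto_nhds.1 hzero) _ hε2)
    filter_upwards [hs.eventually_ge_atTop (max t₀ 0)] with k hk
    have hk0 : 0 ≤ s k := (le_max_right _ _).trans hk
    have h1 := hLip0 (ε / (2 * T)) (s k) (u k) hk0 (hsu k) (fun r hr => by
      have := ht₀ r (((le_max_left _ _).trans hk).trans hr.1)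
      rw [dist_zero_right] at this
      exact this.le)
    have h2 : u k - s k ≤ T := by
      have := (hu k).2
      rw [max_eq_left hk0] at this
      linarith
    have h3 : ε / (2 * T) * (u k - s k) ≤ ε / (2 * T) * T := by gcongr
    have h4 : ε / (2 * T) * T = ε / 2 := by field_simp
    rw [Real.dist_eq, sub_zero, abs_of_nonneg dist_nonneg, dist_comm]
    linarith
  have hxu : Tendsto (fun k => x (u k)) atTop (𝓝 ξ) := by
    exact (tendsto_iff_of_dist hdist).2 hξ
  have hdomu : ∀ k, (x (u k), γ) ∈ domf := by
    intro k
    have := htraj.mem (u k) (hfc (hu0 k))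
    rwa [hσu k] at this
  have hξdom : (ξ, γ) ∈ domf :=
    hdomf.mem_of_tendsto (hxu.prodMk_nhds (tendsto_const_nhds (x := γ)))
      (Eventually.of_forall hdomu)
  have hξB : ξ ∈ B :=
    hB.isClosed.mem_of_tendsto hxu (Eventually.of_forall fun k => hxB _ (hu0 k))
  have hξO : ξ ∈ Ogamma domV domf γ := ⟨hBO hξB, hξdom⟩
  refine ⟨⟨⟨hξdom, ?_⟩, hξO⟩, ?_⟩
  · have h1 : Tendsto (fun k => (x (u k), γ)) atTop (𝓝[domf] (ξ, γ)) := by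
      rw [tendsto_nhdsWithin_iff]
      exact ⟨hxu.prodMk_nhds tendsto_const_nhds, Eventually.of_forall hdomu⟩
    have h2 := (hf _ hξdom).tendsto.comp h1
    have h3 := hzero.comp hut
    refine tendsto_nhds_unique h2 ?_
    simpa [Function.comp_def, hσu] using h3
  · have h1 : Tendsto (fun k => V (x (u k), γ)) atTop (𝓝 (V (ξ, γ))) :=
      ((hV.diff γ _ hξO).continuousAt.tendsto).comp hxu
    refine tendsto_nhds_unique h1 ?_
    have h2 : Tendsto u atTop (atTop ⊓ 𝓟 {t | σ t = γ}) := by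
      rw [tendsto_inf, tendsto_principal]
      exact ⟨hut, Eventually.of_forall hσu⟩
    have h3 := (hc γ).comp h2
    simpa [Function.comp_def, hσu] using h3

theorem ergodic_convergence
    {n : ℕ} {Γ : Type*} [MetricSpace Γ] [Finite Γ]
    (f : Eucl n × Γ → Eucl n) (domf : Set (Eucl n × Γ))
    (hdomf : IsClosed domf) (hf : ContinuousOn f domf)
    (x : ℝ → Eucl n) (σ : ℝ → Γ) (Ix : Set ℝ)
    (htraj : IsTrajectory f domf x σ Ix) (hfc : Set.Ici (0 : ℝ) ⊆ Ix)
    (hσ : σ ∈ SEall Γ ∩ SDall Γ)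
    (V : Eucl n × Γ → ℝ) (domV : Set (Eucl n × Γ)) (W : Eucl n × Γ → ℝ) :
    ((AssumptionA1 domf V domV x σ Ix ∧ Wineq f V W domV domf) →
      CondEquilObs f domf domV W →
      (∃ c : ℝ, ConvergesTo x
          (⋂ γ : Γ, Egamma f domf γ ∩ {ξ : Eucl n | V (ξ, γ) = c})) ∧
      ((∀ c : ℝ, IsDiscreteSet
          (⋂ γ : Γ, Egamma f domf γ ∩ {ξ : Eucl n | V (ξ, γ) = c})) →
        ∃ xe ∈ ⋂ γ : Γ, Egamma f domf γ ∩ Ogamma domV domf γ,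
          Filter.Tendsto x Filter.atTop (nhds xe))) ∧
    ((AssumptionA2 domf V domV x σ Ix ∧ Wineq f V W domV domf) →
      CondEquilObs f domf domV W →
      ConvergesTo x (⋂ γ : Γ, Egamma f domf γ ∩ Ogamma domV domf γ) ∧
      (IsDiscreteSet (⋂ γ : Γ, Egamma f domf γ ∩ Ogamma domV domf γ) →
        ∃ xe ∈ ⋂ γ : Γ, Egamma f domf γ ∩ Ogamma domV domf γ,
          Filter.Tendsto x Filter.atTop (nhds xe))) := by
  have hxc : ContinuousOn x (Ici 0) := htraj.cont.mono hfc
  constructor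
  · rintro ⟨hA, hW⟩ hE
    obtain ⟨B, hBO, hB, hxB'⟩ := hA.precompact
    have hxB : ∀ t, 0 ≤ t → x t ∈ B := fun t ht => hxB' t (hfc ht)
    have hK : IsCompact (domf ∩ (B ×ˢ (univ : Set Γ))) :=
      (hB.prod isCompact_univ).inter_left hdomf
    have hbd : BddBelow ((fun t => V (x t, σ t)) '' Ici 0) := by
      refine (hK.bddBelow_image (f := V) (hA.contV.mono ?_)).mono ?_
      · exact inter_subset_inter_right _ (prod_mono hBO le_rfl)
      · rintro _ ⟨t, ht, rfl⟩
        exact ⟨_, ⟨htraj.mem t (hfc ht), hxB t ht, mem_univ _⟩, rfl⟩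
    obtain ⟨c, hc⟩ := aux_antitone _ _ hA.nonincr ⟨0, self_mem_Ici⟩ hbd
    have hc' : ∀ γ, Tendsto (fun t => V (x t, σ t)) (atTop ⊓ 𝓟 {t | σ t = γ}) (𝓝 c) := by
      intro γ
      refine hc.mono_left ?_
      refine le_inf inf_le_left ?_
      exact inf_le_left.trans (le_principal_iff.2 (Ici_mem_atTop 0))
    have hmain := aux_main f domf hdomf hf x σ Ix htraj hfc hσ V domV W hA.classV hW hE B hBO hB hxB
      (fun _ => c) hc'
    have hfin := aux_final x hxc B hB hxB
      (⋂ γ : Γ, Egamma f domf γ ∩ {ξ : Eucl n | V (ξ, γ) = c})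
      (fun s ξ hs hξ => mem_iInter.2 fun γ =>
        ⟨(hmain s ξ hs hξ γ).1.1, (hmain s ξ hs hξ γ).2⟩)
    refine ⟨⟨c, hfin.1⟩, fun hD => ?_⟩
    obtain ⟨xe, -, hxe⟩ := hfin.2 (hD c)
    exact ⟨xe, mem_iInter.2 fun γ => (hmain (fun k => (k : ℝ)) xe tendsto_natCast_atTop_atTop
      (hxe.comp tendsto_natCast_atTop_atTop) γ).1, hxe⟩
  · rintro ⟨hA, hW⟩ hE
    obtain ⟨B, hBO, hB, hxB'⟩ := hA.precompact
    have hxB : ∀ t, 0 ≤ t → x t ∈ B := fun t ht => hxB' t (hfc ht)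
    have hc : ∀ γ, ∃ c, Tendsto (fun t => V (x t, σ t)) (atTop ⊓ 𝓟 {t | σ t = γ}) (𝓝 c) := by
      intro γ
      have hK : IsCompact (B ∩ {ξ | (ξ, γ) ∈ domf}) :=
        hB.inter_right (hdomf.preimage (by fun_prop))
      have hbd : BddBelow ((fun t => V (x t, σ t)) '' ({t | σ t = γ} ∩ Ici 0)) := by
        refine (hK.bddBelow_image (f := fun ξ => V (ξ, γ)) ?_).mono ?_
        · intro ξ hξ
          exact (hA.classV.diff γ ξ ⟨hBO hξ.1, hξ.2⟩).continuousAt.continuousWithinAt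
        · rintro _ ⟨t, ⟨ht1, ht⟩, rfl⟩
          have ht1 : σ t = γ := ht1
          have hm := htraj.mem t (hfc ht)
          simp only [ht1] at hm ⊢
          exact ⟨x t, ⟨hxB t ht, hm⟩, rfl⟩
      have hne : ({t | σ t = γ} ∩ Ici 0).Nonempty := by
        obtain ⟨T, -, hTe⟩ := mem_iUnion₂.1 hσ.1
        obtain ⟨t, ht, h⟩ := hTe 0 le_rfl γ
        exact ⟨t, h, ht.1⟩
      obtain ⟨c, hc⟩ := aux_antitone _ _ (hA.nonincr γ) hne hbd
      refine ⟨c, hc.mono_left ?_⟩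
      refine le_inf inf_le_left ?_
      rw [← inf_principal]
      exact le_inf inf_le_right (inf_le_left.trans (le_principal_iff.2 (Ici_mem_atTop 0)))
    choose c hc using hc
    have hmain := aux_main f domf hdomf hf x σ Ix htraj hfc hσ V domV W hA.classV hW hE B hBO hB hxB
      c hc
    exact aux_final x hxc B hB hxB _
      (fun s ξ hs hξ => mem_iInter.2 fun γ => (hmain s ξ hs hξ γ).1)
end
end

section
/- Suppose Assumptions (E0) and (U) hold and let (x,σ) be a forward complete trajectory of the switched system ẋ = f(x,σ) with σ ∈ S_a. (1) If Assumption (A4) is satisfied, 0 ∈ O, and (a) O_γ^f(f_γ,W_γ,∞) ∩ O_γ^b(f_γ,W_γ,∞) ⊆ {0} for every γ ∈ Γ, and (b) O_γ^b(f_γ,W_γ) ∩ O_{γ′}^f(f_{γ′},W_{γ′}) ⊆ {0} for all γ ≠ γ′ in Γ, then x(t) → 0 as t → +∞; if Γ is finite, the same conclusion holds with Assumption (A5) in place of Assumption (A4). (2) If Assumption (A3) is satisfied, 0 ∈ O, condition (a) holds, and (b′) O_γ^b(f_γ,W_γ) ∩ O_{γ′}^f(f_{γ′},W_{γ′}) ∩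 V_γ⁻¹(c) ∩ V_{γ′}⁻¹(c) ⊆ {0} for all γ ≠ γ′ in Γ and all c ∈ ℝ, then x(t) → 0 as t → +∞. -/
open Filter Topology MeasureTheory Set

noncomputable section
/-- FTC criterion for being a solution. -/
theorem isSolOn_of_deriv {n : ℕ} {g : Eucl n → Eucl n} {X : Set (Eucl n)}
    {y : ℝ → Eucl n} (hy : Continuous y) {I : Set ℝ} (hI : I.OrdConnected)
    (hX : ∀ t ∈ I, y t ∈ X) (hg : ContinuousOn g X) {C : Set ℝ} (hC : C.Countable)
    (hd : ∀ t ∈ interior I \ C, HasDerivAt y (g (y t)) t) : IsSolOn g X y I := by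
  refine ⟨hy.continuousOn, hX, fun t₀ h₀ t ht => ?_⟩
  have hsub : uIcc t₀ t ⊆ I := hI.uIcc_subset h₀ ht
  have hc : ContinuousOn (fun s => g (y s)) (uIcc t₀ t) :=
    hg.comp hy.continuousOn (fun s hs => hX s (hsub hs))
  have hi := hc.intervalIntegrable (μ := volume)
  refine ⟨hi, ?_⟩
  have := MeasureTheory.integral_eq_of_hasDerivAt_off_countable y (fun s => g (y s)) hC
    hy.continuousOn (a := t₀) (b := t) (fun s hs => hd s ⟨?_, hs.2⟩) hi
  · rw [this]; abel
  · have : Ioo (min t₀ t) (max t₀ t) ⊆ interior I :=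
      interior_maximal (Ioo_subset_Icc_self.trans hsub) isOpen_Ioo
    exact this hs.1

theorem IsSolOn.hasDerivWithinAt {n : ℕ} {g : Eucl n → Eucl n} {X : Set (Eucl n)}
    {y : ℝ → Eucl n} {a b : ℝ} (hg : ContinuousOn g X) (h : IsSolOn g X y (Icc a b))
    {t : ℝ} (ht : t ∈ Icc a b) : HasDerivWithinAt y (g (y t)) (Icc a b) t := by
  have hc : ContinuousOn (fun s => g (y s)) (Icc a b) := hg.comp h.1 h.2.1
  have ha : a ∈ Icc a b := ⟨le_rfl, ht.1.trans ht.2⟩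
  have := Fact.mk ht
  have h1 : HasDerivWithinAt (fun u => ∫ s in a..u, g (y s)) (g (y t)) (Icc a b) t :=
    intervalIntegral.integral_hasDerivWithinAt_right (h.2.2 a ha t ht).1
      (hc.stronglyMeasurableAtFilter_nhdsWithin measurableSet_Icc t) (hc t ht)
  have h2 := h1.const_add (y a)
  exact h2.congr (fun s hs => (h.2.2 a ha s hs).2) (h.2.2 a ha t ht).2

/-- A switching signal without jumps in an open interval is constant there. -/
theorem const_of_noJump {Γ : Type*} [MetricSpace Γ] {σ : ℝ → Γ} (hσ : IsSwitchingSignal σ)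
    {a b : ℝ} (h : ∀ r ∈ Ioo a b, ContinuousAt σ r) :
    ∀ r ∈ Ioo a b, ∀ r' ∈ Ioo a b, σ r = σ r' := by
  intro r hr r' hr'
  refine isPreconnected_Ioo.induction₂ (fun u v => σ u = σ v) ?_ ?_ ?_ hr hr'
  · intro t ht
    refine mem_nhdsWithin_of_mem_nhds ?_
    obtain ⟨e1, he1, h1⟩ := hσ.rightConst t
    obtain ⟨e2, he2, h2⟩ := hσ.leftConst t
    filter_upwards [Ioo_mem_nhds (show t - e2 < t by linarith) (show t < t + e1 by linarith)]
      with s hs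
    rcases lt_or_ge s t with hlt | hge
    · have hc : Tendsto σ (𝓝[<] t) (𝓝 (σ t)) := (h t ht).tendsto.mono_left nhdsWithin_le_nhds
      have hc2 : Tendsto σ (𝓝[<] t) (𝓝 (σ s)) := by
        refine tendsto_const_nhds.congr' ?_
        filter_upwards [Ioo_mem_nhdsLT (show t - e2 < t by linarith)] with u hu
        exact h2 s ⟨hs.1, hlt⟩ u hu
      exact tendsto_nhds_unique hc hc2
    · exact (h1 s ⟨hge, hs.2⟩).symm
  · intro u v w _ _ _ h1 h2; exact h1.trans h2
  · intro u v _ _ h1; exact h1.symm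

/-- Limit data of a trajectory along an ultrafilter. -/
structure LimData {n : ℕ} {Γ : Type*} [MetricSpace Γ]
    (f : Eucl n × Γ → Eucl n) (domf : Set (Eucl n × Γ)) (x : ℝ → Eucl n) (σ : ℝ → Γ)
    (B : Set (Eucl n)) (U : Ultrafilter ℝ) (xs : ℝ → Eucl n) (ss : ℝ → Γ) : Prop where
  closed : IsClosed domf
  contf : ContinuousOn f domf
  top : (U : Filter ℝ) ≤ atTop
  compB : IsCompact B
  memB : ∀ t, 0 ≤ t → x t ∈ B
  mem : ∀ t, 0 ≤ t → (x t, σ t) ∈ domf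
  lip : ∃ M, 0 ≤ M ∧ ∀ t, 0 ≤ t → ∀ t', 0 ≤ t' → dist (x t) (x t') ≤ M * |t - t'|
  der : ∀ u e, 0 < e → e < u → (∀ r ∈ Ioo (u - e) (u + e), σ r = σ u) →
    HasDerivAt x (f (x u, σ u)) u
  limx : ∀ t, Tendsto (fun s => x (s + t)) U (𝓝 (xs t))
  lims : ∀ t, Tendsto (fun s => σ (s + t)) U (𝓝 (ss t))

theorem exists_limData {n : ℕ} {Γ : Type*} [MetricSpace Γ] [CompactSpace Γ]
    {f : Eucl n × Γ → Eucl n} {domf : Set (Eucl n × Γ)}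
    (hdomf : IsClosed domf) (hf : ContinuousOn f domf)
    {x : ℝ → Eucl n} {σ : ℝ → Γ} {Ix : Set ℝ}
    (htraj : IsTrajectory f domf x σ Ix) (hfc : Set.Ici (0 : ℝ) ⊆ Ix)
    {B : Set (Eucl n)} (hB : IsCompact B) (hxB : ∀ t ∈ Ix, x t ∈ B)
    (hx : ¬ Tendsto x atTop (𝓝 0)) :
    ∃ (U : Ultrafilter ℝ) (xs : ℝ → Eucl n) (ss : ℝ → Γ),
      LimData f domf x σ B U xs ss ∧ xs 0 ≠ 0 := by
  obtain ⟨S, hS, hfr⟩ := not_tendsto_iff_exists_frequently_notMem.1 hx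
  have : NeBot (atTop ⊓ 𝓟 {t | x t ∉ S}) := frequently_mem_iff_neBot.1 hfr
  let U := Ultrafilter.of (atTop ⊓ 𝓟 {t | x t ∉ S})
  have hU : (U : Filter ℝ) ≤ atTop ⊓ 𝓟 {t | x t ∉ S} := Ultrafilter.of_le _
  have htop : (U : Filter ℝ) ≤ atTop := hU.trans inf_le_left
  have hge : ∀ c : ℝ, ∀ᶠ s in (U : Filter ℝ), c ≤ s := fun c => htop (eventually_ge_atTop c)
  have h1 : ∀ t, ∃ y, Tendsto (fun s => x (s + t)) U (𝓝 y) := by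
    intro t
    have : ∀ᶠ s in (U : Filter ℝ), x (s + t) ∈ B := by
      filter_upwards [hge (-t)] with s hs
      exact hxB _ (hfc (by simp; linarith))
    obtain ⟨y, _, hy⟩ := hB.ultrafilter_le_nhds (U.map (fun s => x (s + t)))
      (le_principal_iff.2 this)
    exact ⟨y, hy⟩
  have h2 : ∀ t, ∃ y, Tendsto (fun s => σ (s + t)) U (𝓝 y) := by
    intro t
    obtain ⟨y, _, hy⟩ := isCompact_univ.ultrafilter_le_nhds (U.map (fun s => σ (s + t)))
      (by simp)
    exact ⟨y, hy⟩
  choose xs hxs using h1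
  choose ss hss using h2
  refine ⟨U, xs, ss, ⟨hdomf, hf, htop, hB, fun t ht => hxB t (hfc ht),
    fun t ht => htraj.mem t (hfc ht), ?_, ?_, hxs, hss⟩, ?_⟩
  · have hK : IsCompact (domf ∩ (B ×ˢ (univ : Set Γ))) :=
      (hB.prod isCompact_univ).inter_left hdomf
    obtain ⟨M, hM⟩ := hK.exists_bound_of_continuousOn (hf.mono inter_subset_left)
    refine ⟨max M 0, le_max_right _ _, fun t ht t' ht' => ?_⟩
    have := (htraj.intg t' (hfc ht') t (hfc ht)).2
    rw [dist_eq_norm, this, add_sub_cancel_left]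
    refine intervalIntegral.norm_integral_le_of_norm_le_const (fun s hs => ?_)
    have hs0 : 0 ≤ s := (le_min ht' ht).trans (uIoc_subset_uIcc hs).1
    exact (hM _ ⟨htraj.mem s (hfc hs0), hxB s (hfc hs0), trivial⟩).trans (le_max_left _ _)
  · intro u e he heu hc
    have hpos : ∀ r ∈ Ioo (u - e) (u + e), r ∈ Ix := fun r hr => hfc (by
      have := hr.1; simp; linarith)
    have hcont : ContinuousOn (fun s => f (x s, σ s)) (Ioo (u - e) (u + e)) := by
      refine hf.comp ((htraj.cont.mono hpos).prodMk ?_) (fun s hs => htraj.mem s (hpos s hs))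
      exact (continuousOn_const (c := σ u)).congr hc
    have hu : u ∈ Ioo (u - e) (u + e) := ⟨by linarith, by linarith⟩
    have hn : Ioo (u - e) (u + e) ∈ 𝓝 u := isOpen_Ioo.mem_nhds hu
    have h3 := intervalIntegral.integral_hasDerivAt_right
      (htraj.intg u (hpos u hu) u (hpos u hu)).1
      (hcont.stronglyMeasurableAtFilter isOpen_Ioo u hu) (hcont.continuousAt hn)
    refine (h3.const_add (x u)).congr_of_eventuallyEq ?_
    filter_upwards [hn] with r hr
    exact (htraj.intg u (hpos u hu) r (hpos r hr)).2
  · intro h0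
    have h4 := hxs 0
    rw [h0] at h4
    simp only [add_zero] at h4
    have h5 : ∀ᶠ s in (U : Filter ℝ), x s ∈ S := h4 hS
    have h6 : ∀ᶠ s in (U : Filter ℝ), x s ∉ S := (hU.trans inf_le_right) (mem_principal_self _)
    obtain ⟨s, h7, h8⟩ := (h5.and h6).exists
    exact h8 h7

/-- Regular times of the limit. -/
def RegT {Γ : Type*} (σ : ℝ → Γ) (U : Ultrafilter ℝ) (t : ℝ) : Prop :=
  ∃ e > (0 : ℝ), ∀ᶠ s in (U : Filter ℝ), ∀ r ∈ Ioo (t - e) (t + e), σ (s + r) = σ (s + t)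

theorem nonreg_finite {Γ : Type*} [MetricSpace Γ] {σ : ℝ → Γ} (hσ : σ ∈ SAall Γ)
    (U : Ultrafilter ℝ) (T : ℝ) : ({t | ¬ RegT σ U t} ∩ Ioo (-T) T).Finite := by
  simp only [SAall, mem_iUnion, exists_prop] at hσ
  obtain ⟨τD, hτ, N₀, hsw, hN⟩ := hσ
  by_contra hinf
  obtain ⟨F, hF, hcard⟩ := Set.Infinite.exists_subset_card_eq hinf (⌈(N₀ : ℝ) + (2 * T) / τD⌉₊ + 1)
  have hTF : ∀ t ∈ F, ¬ RegT σ U t ∧ -T < t ∧ t < T := fun t ht => hF ht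
  have hne : F.Nonempty := by rw [← Finset.card_pos]; omega
  have hT : -T < T := by obtain ⟨t, ht⟩ := hne; have := hTF t ht; linarith
  have hsep : ∀ᶠ e in 𝓝[>] (0 : ℝ), 0 < e ∧ ∀ t ∈ F, (-T < t - e ∧ t + e < T) ∧
      ∀ t' ∈ F, t ≠ t' → 2 * e < |t - t'| := by
    have key : ∀ c : ℝ, 0 < c → ∀ᶠ e in 𝓝[>] (0 : ℝ), e < c := fun c hc =>
      mem_nhdsWithin_of_mem_nhds (Iio_mem_nhds hc)
    refine (eventually_mem_nhdsWithin).and ?_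
    rw [Filter.eventually_all_finset]
    intro t ht
    refine Eventually.and ?_ ?_
    · filter_upwards [key (t + T) (by linarith [hTF t ht]), key (T - t) (by linarith [hTF t ht])]
        with e h1 h2
      constructor <;> linarith
    · rw [Filter.eventually_all_finset]
      intro t' ht'
      by_cases h : t = t'
      · simp [h]
      · have : 0 < |t - t'| := abs_pos.2 (sub_ne_zero.2 h)
        filter_upwards [key (|t - t'| / 2) (by linarith)] with e h1 _
        linarith
  obtain ⟨e, he, hsep⟩ := hsep.exists
  have hj : ∀ᶠ s in (U : Filter ℝ), ∀ t ∈ F, ∃ j ∈ JumpTimes σ, s + t - e < j ∧ j < s + t + e := by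
    rw [Filter.eventually_all_finset]
    intro t ht
    have h1 := (hTF t ht).1
    have h2 : ∀ᶠ s in (U : Filter ℝ), ¬ ∀ r ∈ Ioo (t - e) (t + e), σ (s + r) = σ (s + t) := by
      rw [Ultrafilter.eventually_not]
      exact fun h => h1 ⟨e, he, h⟩
    filter_upwards [h2] with s hs
    by_contra! hcon
    apply hs
    intro r hr
    refine const_of_noJump hsw (a := s + t - e) (b := s + t + e) (fun q hq => ?_) _
      ⟨by linarith [hr.1], by linarith [hr.2]⟩ _ ⟨by linarith, by linarith⟩
    by_contra hq'
    exact absurd hq.2 (not_lt.2 (hcon q hq' hq.1))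
  obtain ⟨s, hs⟩ := hj.exists
  choose! j hjJ hj1 hj2 using hs
  have hfin : (JumpTimes σ ∩ Ioo (s - T) (s + T)).Finite :=
    (hsw.locFinite (s - T) (s + T)).subset (inter_subset_inter_right _ Ioo_subset_Icc_self)
  have hle : F.card ≤ (JumpTimes σ ∩ Ioo (s - T) (s + T)).ncard := by
    rw [← Set.ncard_coe_finset F]
    refine Set.ncard_le_ncard_of_injOn j (fun t ht => ⟨hjJ t ht, ?_, ?_⟩) ?_ hfin
    · have := (hsep t ht).1; linarith [hj1 t ht]
    · have := (hsep t ht).1; linarith [hj2 t ht]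
    · intro t ht t' ht' heq
      by_contra hne'
      have h1 := (hsep t ht).2 t' ht' hne'
      have := hj1 t ht; have := hj2 t ht; have := hj1 t' ht'; have := hj2 t' ht'
      have : |t - t'| < 2 * e := by rw [abs_lt]; constructor <;> linarith
      linarith
  have h2 := hN (s - T) (s + T) (by linarith)
  have h3 : ((F.card : ℕ) : ℝ) ≤ N₀ + 2 * T / τD := by
    refine le_trans (by exact_mod_cast hle) (h2.trans (le_of_eq ?_))
    congr 2; ring
  have h4 := Nat.le_ceil ((N₀ : ℝ) + (2 * T) / τD)
  rw [hcard] at h3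
  push_cast at h3
  linarith

theorem punct_reg {Γ : Type*} [MetricSpace Γ] {σ : ℝ → Γ} (hσ : σ ∈ SAall Γ)
    (U : Ultrafilter ℝ) (t₀ : ℝ) :
    ∃ d > (0 : ℝ), ∀ r ∈ Ioo (t₀ - d) (t₀ + d), r ≠ t₀ → RegT σ U r := by
  have hfin := nonreg_finite hσ U (|t₀| + 1)
  have h1 : (({t | ¬ RegT σ U t} ∩ Ioo (-(|t₀| + 1)) (|t₀| + 1)) \ {t₀})ᶜ ∈ 𝓝 t₀ :=
    (hfin.subset sdiff_subset).isClosed.isOpen_compl.mem_nhds (by simp)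
  have h2 : Ioo (-(|t₀| + 1)) (|t₀| + 1) ∈ 𝓝 t₀ :=
    Ioo_mem_nhds (by linarith [neg_abs_le t₀]) (by linarith [le_abs_self t₀])
  obtain ⟨d, hd, hsub⟩ := Metric.mem_nhds_iff.1 (inter_mem h1 h2)
  refine ⟨d, hd, fun r hr hne => ?_⟩
  rw [Real.ball_eq_Ioo] at hsub
  by_contra hreg
  exact (hsub hr).1 ⟨⟨hreg, (hsub hr).2⟩, hne⟩

theorem nonreg_countable {Γ : Type*} [MetricSpace Γ] {σ : ℝ → Γ} (hσ : σ ∈ SAall Γ)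
    (U : Ultrafilter ℝ) : {t | ¬ RegT σ U t}.Countable := by
  have : {t | ¬ RegT σ U t} ⊆ ⋃ k : ℕ, ({t | ¬ RegT σ U t} ∩ Ioo (-(k : ℝ)) k) := by
    intro t ht
    obtain ⟨k, hk⟩ := exists_nat_gt |t|
    exact mem_iUnion.2 ⟨k, ht, abs_lt.1 hk⟩
  exact (countable_iUnion fun k : ℕ => (nonreg_finite hσ U k).countable).mono this

section Lim
variable {n : ℕ} {Γ : Type*} [MetricSpace Γ]
    {f : Eucl n × Γ → Eucl n} {domf : Set (Eucl n × Γ)} {x : ℝ → Eucl n} {σ : ℝ → Γ}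
    {B : Set (Eucl n)} {U : Ultrafilter ℝ} {xs : ℝ → Eucl n} {ss : ℝ → Γ}

theorem LimData.ge (h : LimData f domf x σ B U xs ss) (c : ℝ) :
    ∀ᶠ s in (U : Filter ℝ), c ≤ s := h.top (eventually_ge_atTop c)

theorem LimData.xsB (h : LimData f domf x σ B U xs ss) (t : ℝ) : xs t ∈ B := by
  refine h.compB.isClosed.mem_of_tendsto (h.limx t) ?_
  filter_upwards [h.ge (-t)] with s hs
  exact h.memB _ (by linarith)

theorem LimData.xsdom (h : LimData f domf x σ B U xs ss) (t : ℝ) : (xs t, ss t) ∈ domf := by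
  refine h.closed.mem_of_tendsto ((h.limx t).prodMk_nhds (h.lims t)) ?_
  filter_upwards [h.ge (-t)] with s hs
  exact h.mem _ (by linarith)

theorem LimData.xscont (h : LimData f domf x σ B U xs ss) : Continuous xs := by
  obtain ⟨M, hM0, hM⟩ := h.lip
  have : LipschitzWith (Real.toNNReal M) xs := by
    refine LipschitzWith.of_dist_le_mul (fun t t' => ?_)
    rw [Real.coe_toNNReal M hM0]
    refine le_of_tendsto ((h.limx t).dist (h.limx t')) ?_
    filter_upwards [h.ge (-t), h.ge (-t')] with s hs hs'
    have := hM (s + t) (by linarith) (s + t') (by linarith)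
    rwa [add_sub_add_left_eq_sub] at this
  exact this.continuous

theorem LimData.limx' (h : LimData f domf x σ B U xs ss) {τ : ℝ → ℝ} {r : ℝ}
    (hτ : Tendsto τ U (𝓝 r)) : Tendsto (fun s => x (s + τ s)) U (𝓝 (xs r)) := by
  obtain ⟨M, hM0, hM⟩ := h.lip
  refine (h.limx r).congr_dist ?_
  have h1 : Tendsto (fun s => M * |r - τ s|) U (𝓝 0) := by
    have := ((tendsto_const_nhds (x := r)).sub hτ).abs.const_mul M
    simpa using this
  refine squeeze_zero' (Eventually.of_forall fun _ => dist_nonneg) ?_ h1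
  have h2 : ∀ᶠ s in (U : Filter ℝ), r - 1 < τ s := hτ (Ioi_mem_nhds (by linarith))
  filter_upwards [h2, h.ge (1 - r)] with s hs hs'
  have := hM (s + r) (by linarith) (s + τ s) (by linarith)
  rwa [add_sub_add_left_eq_sub] at this

/-- near a regular time. -/
theorem LimData.reg_const (h : LimData f domf x σ B U xs ss) {t e : ℝ}
    (hr : ∀ᶠ s in (U : Filter ℝ), ∀ r ∈ Ioo (t - e) (t + e), σ (s + r) = σ (s + t))
    {r : ℝ} (hre : r ∈ Ioo (t - e) (t + e)) : ss r = ss t := by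
  refine tendsto_nhds_unique (h.lims r) ((h.lims t).congr' ?_)
  filter_upwards [hr] with s hs
  exact (hs r hre).symm

theorem LimData.ev_der (h : LimData f domf x σ B U xs ss) {t e : ℝ} (he : 0 < e)
    (hr : ∀ᶠ s in (U : Filter ℝ), ∀ r ∈ Ioo (t - e) (t + e), σ (s + r) = σ (s + t)) :
    ∀ᶠ s in (U : Filter ℝ), ∀ r ∈ Icc (t - e / 2) (t + e / 2),
      0 ≤ s + r ∧ σ (s + r) = σ (s + t) ∧
      HasDerivAt (fun q => x (s + q)) (f (x (s + r), σ (s + t))) r := by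
  filter_upwards [hr, h.ge (-t + 2 * e)] with s hs hs2 r hr'
  have hrm : r ∈ Ioo (t - e) (t + e) := ⟨by linarith [hr'.1], by linarith [hr'.2]⟩
  refine ⟨by linarith [hr'.1], hs r hrm, ?_⟩
  have h1 := h.der (s + r) (e / 2) (by linarith) (by linarith [hr'.1]) (fun q hq => by
    have h2 := hs (q - s) ⟨by linarith [hr'.1, hq.1], by linarith [hr'.2, hq.2]⟩
    rw [add_sub_cancel] at h2
    rw [h2, hs r hrm])
  rw [hs r hrm] at h1
  exact h1.comp_const_add s r

theorem LimData.hasDerivAt (h : LimData f domf x σ B U xs ss) {t : ℝ} (hreg : RegT σ U t) :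
    HasDerivAt xs (f (xs t, ss t)) t := by
  obtain ⟨e, he, hr⟩ := hreg
  have hev := h.ev_der he hr
  have hd : ∀ r ∈ Icc (t - e / 2) (t + e / 2), (xs r, ss t) ∈ domf := by
    intro r hr'
    have := h.xsdom r
    rwa [h.reg_const hr ⟨by linarith [hr'.1], by linarith [hr'.2]⟩] at this
  refine hasDerivAt_of_tendstoUniformlyOn (l := (U : Filter ℝ))
    (s := Ioo (t - e / 2) (t + e / 2))
    (f := fun s r => x (s + r)) (f' := fun s r => f (x (s + r), σ (s + t)))
    (g' := fun r => f (xs r, ss t)) isOpen_Ioo ?_ ?_ (fun r _ => h.limx r)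
    ⟨by linarith, by linarith⟩
  · rw [Metric.tendstoUniformlyOn_iff]
    intro ε hε
    by_contra hcon
    rw [← Ultrafilter.eventually_not] at hcon
    have hcon' : ∀ s, ∃ r ∈ Icc (t - e / 2) (t + e / 2),
        (¬ ∀ r ∈ Ioo (t - e / 2) (t + e / 2),
          dist (f (xs r, ss t)) (f (x (s + r), σ (s + t))) < ε) →
        ε ≤ dist (f (xs r, ss t)) (f (x (s + r), σ (s + t))) := by
      intro s
      by_cases hc : ∀ r ∈ Ioo (t - e / 2) (t + e / 2),
          dist (f (xs r, ss t)) (f (x (s + r), σ (s + t))) < ε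
      · exact ⟨t, ⟨by linarith, by linarith⟩, fun h => absurd hc h⟩
      · push Not at hc
        obtain ⟨r, h1, h2⟩ := hc
        exact ⟨r, Ioo_subset_Icc_self h1, fun _ => h2⟩
    choose τ hτ1 hτ2 using hcon'
    obtain ⟨r, hrI, hτ⟩ := isCompact_Icc.ultrafilter_le_nhds (U.map τ)
      (le_principal_iff.2 (Eventually.of_forall hτ1 : ∀ᶠ s in (U : Filter ℝ), τ s ∈ Icc (t - e / 2) (t + e / 2)))
    replace hτ : Tendsto τ U (𝓝 r) := hτ
    have hfc := h.contf (xs r, ss t) (hd r hrI)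
    have l1 : Tendsto (fun s => f (x (s + τ s), σ (s + t))) U (𝓝 (f (xs r, ss t))) := by
      refine hfc.tendsto.comp (tendsto_nhdsWithin_iff.2
        ⟨(h.limx' hτ).prodMk_nhds (h.lims t), ?_⟩)
      filter_upwards [hev] with s hs
      obtain ⟨h0, h1, _⟩ := hs (τ s) (hτ1 s)
      have := h.mem _ h0
      rwa [h1] at this
    have l2 : Tendsto (fun s => f (xs (τ s), ss t)) U (𝓝 (f (xs r, ss t))) := by
      refine hfc.tendsto.comp (tendsto_nhdsWithin_iff.2
        ⟨((h.xscont.tendsto r).comp hτ).prodMk_nhds tendsto_const_nhds, ?_⟩)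
      exact Eventually.of_forall fun s => hd _ (hτ1 s)
    have l3 := l2.dist l1
    rw [dist_self] at l3
    have : ε ≤ 0 := ge_of_tendsto l3 (by
      filter_upwards [hcon] with s hs
      exact hτ2 s hs)
    linarith
  · filter_upwards [hev] with s hs r hr'
    exact (hs r (Ioo_subset_Icc_self hr')).2.2

theorem LimData.const_Ioo (h : LimData f domf x σ B U xs ss) {a b : ℝ}
    (hreg : ∀ r ∈ Ioo a b, RegT σ U r) : ∀ r ∈ Ioo a b, ∀ r' ∈ Ioo a b, ss r = ss r' := by
  intro r hr r' hr'
  refine isPreconnected_Ioo.induction₂ (fun u v => ss u = ss v) ?_ ?_ ?_ hr hr'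
  · intro t ht
    obtain ⟨e, he, hev⟩ := hreg t ht
    refine mem_nhdsWithin_of_mem_nhds ?_
    filter_upwards [Ioo_mem_nhds (show t - e < t by linarith) (show t < t + e by linarith)]
      with q hq
    exact (h.reg_const hev hq).symm
  · intro u v w _ _ _ h1 h2; exact h1.trans h2
  · intro u v _ _ h1; exact h1.symm

/-- An interval on whose interior the limit is regular with value `γ`. -/
def SegOK (σ : ℝ → Γ) (U : Ultrafilter ℝ) (ss : ℝ → Γ) (γ : Γ) (a b : ℝ) : Prop :=
  a < b ∧ ∀ r ∈ Ioo a b, RegT σ U r ∧ ss r = γ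

theorem LimData.seg_right (h : LimData f domf x σ B U xs ss) (hσ : σ ∈ SAall Γ) (t₀ : ℝ) :
    ∃ d > 0, ∃ γ₁ γ₂, SegOK σ U ss γ₁ (t₀ - d) t₀ ∧ SegOK σ U ss γ₂ t₀ (t₀ + d) := by
  obtain ⟨d, hd, hreg⟩ := punct_reg hσ U t₀
  have r1 : ∀ r ∈ Ioo (t₀ - d) t₀, RegT σ U r := fun r hr =>
    hreg r ⟨hr.1, by linarith [hr.2]⟩ hr.2.ne
  have r2 : ∀ r ∈ Ioo t₀ (t₀ + d), RegT σ U r := fun r hr =>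
    hreg r ⟨by linarith [hr.1], hr.2⟩ hr.1.ne'
  refine ⟨d, hd, ss (t₀ - d / 2), ss (t₀ + d / 2), ⟨by linarith, fun r hr => ⟨r1 r hr, ?_⟩⟩,
    ⟨by linarith, fun r hr => ⟨r2 r hr, ?_⟩⟩⟩
  · exact h.const_Ioo r1 r hr _ ⟨by linarith, by linarith⟩
  · exact h.const_Ioo r2 r hr _ ⟨by linarith, by linarith⟩

theorem LimData.seg_dom (h : LimData f domf x σ B U xs ss) {γ : Γ} {a b : ℝ}
    (hs : SegOK σ U ss γ a b) : ∀ t ∈ Icc a b, (xs t, γ) ∈ domf := by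
  have hcl : IsClosed {t | (xs t, γ) ∈ domf} :=
    h.closed.preimage (h.xscont.prodMk continuous_const)
  have : Ioo a b ⊆ {t | (xs t, γ) ∈ domf} := fun t ht => by
    have := h.xsdom t
    rwa [(hs.2 t ht).2] at this
  have h2 := closure_minimal this hcl
  rwa [closure_Ioo hs.1.ne] at h2

theorem contf_slice {domf : Set (Eucl n × Γ)} {F : Eucl n × Γ → Eucl n}
    (hf : ContinuousOn F domf) (γ : Γ) {X : Set (Eucl n)}
    (hX : ∀ ξ ∈ X, (ξ, γ) ∈ domf) : ContinuousOn (fun ξ => F (ξ, γ)) X :=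
  hf.comp (Continuous.prodMk_left γ).continuousOn hX

/-- Solutions on segments (shifted). -/
theorem LimData.seg_sol (h : LimData f domf x σ B U xs ss) {γ : Γ} {a b : ℝ}
    (hs : SegOK σ U ss γ a b) {X : Set (Eucl n)} (hXd : ∀ ξ ∈ X, (ξ, γ) ∈ domf)
    (hBX : ∀ ξ ∈ B, (ξ, γ) ∈ domf → ξ ∈ X) (t₀ : ℝ) :
    IsSolOn (fun ξ => f (ξ, γ)) X (fun r => xs (t₀ + r)) (Icc (a - t₀) (b - t₀)) := by
  refine isSolOn_of_deriv (y := fun r => xs (t₀ + r)) (h.xscont.comp (by fun_prop))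
    ordConnected_Icc
    (fun t ht => hBX _ (h.xsB _) (h.seg_dom hs (t₀ + t) ⟨by linarith [ht.1], by linarith [ht.2]⟩))
    (contf_slice h.contf γ hXd) countable_empty (fun t ht => ?_)
  rw [interior_Icc] at ht
  have h1 := hs.2 (t₀ + t) ⟨by linarith [ht.1.1], by linarith [ht.1.2]⟩
  have h2 := h.hasDerivAt h1.1
  rw [h1.2] at h2
  exact h2.comp_const_add t₀ t

theorem LimData.zero_all (h : LimData f domf x σ B U xs ss) (hσ : σ ∈ SAall Γ)
    (hE0 : AssumpE0 f domf) (hU : AssumpU f domf) {t₁ : ℝ} (h0 : xs t₁ = 0) (t : ℝ) :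
    xs t = 0 := by
  have key : ∀ γ a b t₀, SegOK σ U ss γ a b → t₀ ∈ Icc a b → xs t₀ = 0 →
      ∀ t ∈ Icc a b, xs t = 0 := by
    intro γ a b t₀ hs ht₀ hz t ht
    have hdom : ((0 : Eucl n), γ) ∈ domf := by
      have := h.seg_dom hs t₀ ht₀
      rwa [hz] at this
    have := hU γ hdom (Icc (a - t₀) (b - t₀)) ordConnected_Icc
      ⟨by linarith [ht₀.1], by linarith [ht₀.2]⟩ (fun r => xs (t₀ + r)) (fun _ => 0)
      (h.seg_sol hs (fun _ h => h) (fun _ _ h => h) t₀)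
      (isSolOn_of_deriv continuous_const ordConnected_Icc (fun _ _ => hdom)
        (contf_slice h.contf γ (fun _ h => h)) countable_empty (fun r _ => by
          rw [hE0 γ hdom]; exact hasDerivAt_const _ _))
      (by simpa using hz) rfl (t - t₀) ⟨by linarith [ht.1], by linarith [ht.2]⟩
    simpa using this
  have hclopen : IsClopen {t | xs t = 0} := by
    refine ⟨isClosed_eq h.xscont continuous_const, isOpen_iff_mem_nhds.2 fun t₀ ht₀ => ?_⟩
    obtain ⟨d, hd, γ₁, γ₂, s1, s2⟩ := h.seg_right hσ t₀
    filter_upwards [Icc_mem_nhds (show t₀ - d < t₀ by linarith) (show t₀ < t₀ + d by linarith)]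
      with q hq
    rcases le_total q t₀ with hle | hle
    · exact key γ₁ _ _ t₀ s1 ⟨by linarith, le_rfl⟩ ht₀ q ⟨hq.1, hle⟩
    · exact key γ₂ _ _ t₀ s2 ⟨le_rfl, by linarith⟩ ht₀ q ⟨hle, hq.2⟩
  have := hclopen.eq_univ ⟨t₁, h0⟩
  exact (this ▸ mem_univ t : t ∈ {t | xs t = 0})

/-- Main abstract conclusion. -/
theorem LimData.finish (h : LimData f domf x σ B U xs ss) (hσ : σ ∈ SAall Γ)
    (hE0 : AssumpE0 f domf) (hU : AssumpU f domf) {domV : Set (Eucl n × Γ)}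
    {W : Eucl n × Γ → ℝ} (hBO : B ⊆ Oset domV) (hA : CondA f domf domV W)
    (P : Eucl n → Γ → Prop)
    (hZ : ∀ γ a b, SegOK σ U ss γ a b → ∀ t ∈ Icc a b, W (xs t, γ) = 0 ∧ P (xs t) γ)
    (hB : ∀ γ γ' : Γ, γ ≠ γ' → ∀ ξ,
      ξ ∈ XBwdFin (Ogamma domV domf γ) (fun ξ => f (ξ, γ)) (fun ξ => W (ξ, γ)) →
      ξ ∈ XFwdFin (Ogamma domV domf γ') (fun ξ => f (ξ, γ')) (fun ξ => W (ξ, γ')) →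
      P ξ γ → P ξ γ' → ξ = 0) : xs 0 = 0 := by
  by_contra hne
  have hnz : ∀ t, xs t ≠ 0 := fun t ht => hne (h.zero_all hσ hE0 hU ht 0)
  have hOd : ∀ γ, ∀ ξ ∈ Ogamma domV domf γ, (ξ, γ) ∈ domf := fun γ ξ hξ => hξ.2
  have hBX : ∀ γ, ∀ ξ ∈ B, (ξ, γ) ∈ domf → ξ ∈ Ogamma domV domf γ :=
    fun γ ξ h1 h2 => ⟨hBO h1, h2⟩
  -- at every time, left and right modes agree
  have hloc : ∀ t₀, ∃ d > 0, ∃ γ, SegOK σ U ss γ (t₀ - d) t₀ ∧ SegOK σ U ss γ t₀ (t₀ + d) := by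
    intro t₀
    obtain ⟨d, hd, γ₁, γ₂, s1, s2⟩ := h.seg_right hσ t₀
    by_cases hg : γ₁ = γ₂
    · subst hg; exact ⟨d, hd, γ₁, s1, s2⟩
    · exfalso
      refine hnz t₀ (hB γ₁ γ₂ hg _ ?_ ?_
        (hZ _ _ _ s1 t₀ ⟨by linarith, le_rfl⟩).2 (hZ _ _ _ s2 t₀ ⟨le_rfl, by linarith⟩).2)
      · refine mem_iUnion₂.2 ⟨d, hd, fun r => xs (t₀ + r), ?_, by simp, fun t ht => ?_⟩
        · have := h.seg_sol s1 (hOd γ₁) (hBX γ₁) t₀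
          simpa using this
        · exact (hZ _ _ _ s1 _ ⟨by linarith [ht.1], by linarith [ht.2]⟩).1
      · refine mem_iUnion₂.2 ⟨d, hd, fun r => xs (t₀ + r), ?_, by simp, fun t ht => ?_⟩
        · have := h.seg_sol s2 (hOd γ₂) (hBX γ₂) t₀
          simpa using this
        · exact (hZ _ _ _ s2 _ ⟨by linarith [ht.1], by linarith [ht.2]⟩).1
  choose d hd g hg1 hg2 using hloc
  -- the mode is globally constant
  have hgc : ∀ t t', g t = g t' := by
    intro t t'
    refine isPreconnected_univ.induction₂ (fun u v => g u = g v) ?_ ?_ ?_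
      (mem_univ t) (mem_univ t')
    · intro t₀ _
      refine mem_nhdsWithin_of_mem_nhds ?_
      filter_upwards [Ioo_mem_nhds (show t₀ - d t₀ < t₀ by linarith [hd t₀])
        (show t₀ < t₀ + d t₀ by linarith [hd t₀])] with q hq
      rcases lt_trichotomy q t₀ with hlt | heq | hgt
      · obtain ⟨r, hr1, hr2⟩ := exists_between (lt_min hlt (show q < q + d q by linarith [hd q]))
        have e1 := ((hg1 t₀).2 r ⟨by linarith [hq.1], hr2.trans_le (min_le_left _ _)⟩).2
        have e2 := ((hg2 q).2 r ⟨hr1, hr2.trans_le (min_le_right _ _)⟩).2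
        rw [← e1, ← e2]
      · rw [heq]
      · obtain ⟨r, hr1, hr2⟩ := exists_between (max_lt hgt (show q - d q < q by linarith [hd q]))
        have e1 := ((hg2 t₀).2 r ⟨(le_max_left _ _).trans_lt hr1, by linarith [hq.2]⟩).2
        have e2 := ((hg1 q).2 r ⟨(le_max_right _ _).trans_lt hr1, hr2⟩).2
        rw [← e1, ← e2]
    · intro u v w _ _ _ h1 h2; exact h1.trans h2
    · intro u v _ _ h1; exact h1.symm
  have hW : ∀ t, W (xs t, g 0) = 0 ∧ (xs t, g 0) ∈ domf := by
    intro t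
    have ht : t ∈ Icc t (t + d t) := ⟨le_rfl, by linarith [hd t]⟩
    rw [hgc 0 t]
    exact ⟨(hZ _ _ _ (hg2 t) t ht).1, h.seg_dom (hg2 t) t ht⟩
  have hss : ∀ t, RegT σ U t → ss t = g 0 := by
    intro t ht
    obtain ⟨e, he, hev⟩ := ht
    obtain ⟨r, hr1, hr2⟩ := exists_between
      (lt_min (show t < t + e by linarith) (show t < t + d t by linarith [hd t]))
    rw [← h.reg_const hev (r := r) ⟨by linarith, hr2.trans_le (min_le_left _ _)⟩, hgc 0 t]
    exact ((hg2 t).2 r ⟨hr1, hr2.trans_le (min_le_right _ _)⟩).2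
  have hsol : ∀ I : Set ℝ, I.OrdConnected →
      IsSolOn (fun ξ => f (ξ, g 0)) (Ogamma domV domf (g 0)) xs I := by
    intro I hI
    refine isSolOn_of_deriv h.xscont hI (fun t _ => hBX _ _ (h.xsB t) (hW t).2)
      (contf_slice h.contf _ (hOd _)) (nonreg_countable hσ U) (fun t ht => ?_)
    have hreg : RegT σ U t := not_not.1 ht.2
    have := h.hasDerivAt hreg
    rwa [hss t hreg] at this
  exact hne (hA (g 0) ⟨⟨xs, hsol _ ordConnected_Ici, rfl, fun t _ => (hW t).1⟩,
    ⟨xs, hsol _ ordConnected_Iic, rfl, fun t _ => (hW t).1⟩⟩)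

/-- Equality of limits along monotone data. -/
theorem LimData.lim_eq (h : LimData f domf x σ B U xs ss) {v : ℝ → ℝ} {A : Set ℝ}
    (hv : AntitoneOn v (A ∩ Ici 0)) {r₁ r₂ L₁ L₂ : ℝ}
    (h1 : ∀ᶠ s in (U : Filter ℝ), s + r₁ ∈ A) (h2 : ∀ᶠ s in (U : Filter ℝ), s + r₂ ∈ A)
    (l1 : Tendsto (fun s => v (s + r₁)) U (𝓝 L₁))
    (l2 : Tendsto (fun s => v (s + r₂)) U (𝓝 L₂)) : L₁ = L₂ := by
  have key : ∀ r₁ r₂ L₁ L₂ : ℝ, (∀ᶠ s in (U : Filter ℝ), s + r₁ ∈ A) →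
      (∀ᶠ s in (U : Filter ℝ), s + r₂ ∈ A) → Tendsto (fun s => v (s + r₁)) U (𝓝 L₁) →
      Tendsto (fun s => v (s + r₂)) U (𝓝 L₂) → L₁ ≤ L₂ := by
    intro r₁ r₂ L₁ L₂ h1 h2 l1 l2
    refine ge_of_tendsto l2 ?_
    filter_upwards [h2, h.ge (-r₂)] with s hs hs0
    refine le_of_tendsto l1 ?_
    filter_upwards [h1, h.ge (-r₁), h.ge (s + r₂ - r₁)] with q hq hq0 hq1
    exact hv ⟨hs, by simp; linarith⟩ ⟨hq, by simp; linarith⟩ (by linarith)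
  exact le_antisymm (key _ _ _ _ h1 h2 l1 l2) (key _ _ _ _ h2 h1 l2 l1)

/-- If `V_γ` is constant along a segment then `W_γ` vanishes on it. -/
theorem LimData.W_zero_of_const (h : LimData f domf x σ B U xs ss)
    {V W : Eucl n × Γ → ℝ} {domV : Set (Eucl n × Γ)} (hBO : B ⊆ Oset domV)
    (hV : ClassVFun V domV domf) (hW : Wineq f V W domV domf) {γ : Γ} {a b c : ℝ}
    (hs : SegOK σ U ss γ a b) (hc : ∀ t ∈ Ioo a b, V (xs t, γ) = c) :
    ∀ t ∈ Icc a b, W (xs t, γ) = 0 ∧ V (xs t, γ) = c := by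
  have hO : ∀ t ∈ Icc a b, xs t ∈ Ogamma domV domf γ :=
    fun t ht => ⟨hBO (h.xsB t), h.seg_dom hs t ht⟩
  have hcont : ContinuousOn (fun t => V (xs t, γ)) (Icc a b) := fun t ht =>
    ((hV.diff γ _ (hO t ht)).continuousAt.comp h.xscont.continuousAt
      (f := xs)).continuousWithinAt
  have hc' : ∀ t ∈ Icc a b, V (xs t, γ) = c := by
    have : EqOn (fun t => V (xs t, γ)) (fun _ => c) (closure (Ioo a b)) := by
      refine EqOn.of_subset_closure (s := Ioo a b) (t := closure (Ioo a b)) hc ?_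
        continuousOn_const subset_closure subset_rfl
      rwa [closure_Ioo hs.1.ne]
    rwa [closure_Ioo hs.1.ne] at this
  intro t ht
  refine ⟨?_, hc' t ht⟩
  have hsol := h.seg_sol hs (X := {ξ | (ξ, γ) ∈ domf}) (fun _ h => h) (fun _ _ h => h) 0
  simp only [sub_zero, zero_add] at hsol
  have hd := hsol.hasDerivWithinAt (contf_slice h.contf γ (fun _ h => h)) ht
  have h1 := (hV.diff γ _ (hO t ht)).hasFDerivAt.comp_hasDerivWithinAt t hd
  have h2 : HasDerivWithinAt ((fun ξ => V (ξ, γ)) ∘ xs) 0 (Icc a b) t :=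
    (hasDerivWithinAt_const t (Icc a b) c).congr hc' (hc' t ht)
  have h3 := (uniqueDiffOn_Icc hs.1 t ht).eq_deriv _ h1 h2
  have h4 := hW γ _ (hO t ht)
  rw [h3] at h4
  linarith

/-- Case (A4). -/
theorem LimData.W_zero_A4 (h : LimData f domf x σ B U xs ss)
    {V W : Eucl n × Γ → ℝ} {domV : Set (Eucl n × Γ)} (hBO : B ⊆ Oset domV)
    (hV : ClassVFun V domV domf) (hW : Wineq f V W domV domf)
    (hWc : ContinuousOn W (domf ∩ (Oset domV ×ˢ (Set.univ : Set Γ))))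
    {M : ℝ} (hM : ∀ t, 0 ≤ t → |V (x t, σ t)| ≤ M)
    (hanti : AntitoneOn (fun t => V (x t, σ t)) (Set.Ici 0)) {γ : Γ} {a b : ℝ}
    (hs : SegOK σ U ss γ a b) : ∀ t ∈ Icc a b, W (xs t, γ) = 0 := by
  have hcont : ContinuousOn (fun t => W (xs t, γ)) (Icc a b) :=
    hWc.comp (h.xscont.prodMk continuous_const).continuousOn
      (fun t ht => ⟨h.seg_dom hs t ht, hBO (h.xsB t), trivial⟩)
  have hlim : ∀ r, ∃ L, Tendsto (fun s => V (x (s + r), σ (s + r))) U (𝓝 L) := by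
    intro r
    have : ∀ᶠ s in (U : Filter ℝ), V (x (s + r), σ (s + r)) ∈ Icc (-M) M := by
      filter_upwards [h.ge (-r)] with s hs
      exact abs_le.1 (hM _ (by linarith))
    obtain ⟨L, _, hL⟩ := isCompact_Icc.ultrafilter_le_nhds
      (U.map (fun s => V (x (s + r), σ (s + r)))) (le_principal_iff.2 this)
    exact ⟨L, hL⟩
  have hint : EqOn (fun t => W (xs t, γ)) (fun _ => 0) (Ioo a b) := by
    intro t ht
    by_contra hne
    have ht' := Ioo_subset_Icc_self ht
    have hpos : 0 < W (xs t, γ) :=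
      lt_of_le_of_ne (hW γ _ ⟨hBO (h.xsB t), h.seg_dom hs t ht'⟩).2 (Ne.symm hne)
    have hca : ContinuousAt (fun t => W (xs t, γ)) t := hcont.continuousAt (Icc_mem_nhds ht.1 ht.2)
    have hev : ∀ᶠ r in 𝓝 t, 0 < W (xs r, γ) := hca.eventually (lt_mem_nhds hpos)
    obtain ⟨⟨e, he, hr⟩, hst⟩ := hs.2 t ht
    obtain ⟨δ, hδ, hball⟩ := Metric.eventually_nhds_iff.1 hev
    obtain ⟨ρ, hρ0, hρ⟩ := exists_between (lt_min hδ (half_pos he))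
    have hρδ := hρ.trans_le (min_le_left _ _)
    have hρe := hρ.trans_le (min_le_right _ _)
    have hdev := h.ev_der he hr
    have hOs : ∀ s r, 0 ≤ s + r → σ (s + r) = σ (s + t) → x (s + r) ∈ Ogamma domV domf (σ (s + t)) := by
      intro s r h0 h1
      refine ⟨hBO (h.memB _ h0), ?_⟩
      have := h.mem _ h0
      rwa [h1] at this
    have hmv : ∀ s, ∃ r ∈ Icc t (t + ρ), (∀ r ∈ Icc (t - e / 2) (t + e / 2),
          0 ≤ s + r ∧ σ (s + r) = σ (s + t) ∧
          HasDerivAt (fun q => x (s + q)) (f (x (s + r), σ (s + t))) r) →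
        W (x (s + r), σ (s + t)) ≤
          (V (x (s + t), σ (s + t)) - V (x (s + (t + ρ)), σ (s + (t + ρ)))) / ρ := by
      intro s
      by_cases hc : (∀ r ∈ Icc (t - e / 2) (t + e / 2),
          0 ≤ s + r ∧ σ (s + r) = σ (s + t) ∧
          HasDerivAt (fun q => x (s + q)) (f (x (s + r), σ (s + t))) r)
      · have hsub : ∀ r ∈ Icc t (t + ρ), r ∈ Icc (t - e / 2) (t + e / 2) := fun r hr =>
          ⟨by linarith [hr.1], by linarith [hr.2]⟩
        have hder : ∀ r ∈ Icc t (t + ρ), HasDerivAt (fun q => V (x (s + q), σ (s + t)))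
            (fderiv ℝ (fun ξ' => V (ξ', σ (s + t))) (x (s + r)) (f (x (s + r), σ (s + t)))) r := by
          intro r hr
          obtain ⟨c1, c2, c3⟩ := hc r (hsub r hr)
          exact (hV.diff _ _ (hOs s r c1 c2)).hasFDerivAt.comp_hasDerivAt r c3
        obtain ⟨r, hr1, hr2⟩ := exists_hasDerivAt_eq_slope
          (fun q => V (x (s + q), σ (s + t))) _ (show t < t + ρ by linarith)
          (fun r hr => (hder r hr).continuousAt.continuousWithinAt)
          (fun r hr => hder r (Ioo_subset_Icc_self hr))
        refine ⟨r, Ioo_subset_Icc_self hr1, fun _ => ?_⟩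
        obtain ⟨c1, c2, c3⟩ := hc r (hsub r (Ioo_subset_Icc_self hr1))
        have h1 := (hW _ _ (hOs s r c1 c2)).1
        rw [hr2] at h1
        rw [(hc (t + ρ) (hsub _ ⟨by linarith, le_rfl⟩)).2.1]
        refine h1.trans (le_of_eq ?_)
        rw [add_sub_cancel_left, ← neg_div, neg_sub]
      · exact ⟨t, ⟨le_rfl, by linarith⟩, fun hh => absurd hh hc⟩
    choose τ hτ1 hτ2 using hmv
    obtain ⟨r, hrI, hτ⟩ := isCompact_Icc.ultrafilter_le_nhds (U.map τ)
      (le_principal_iff.2 (Eventually.of_forall hτ1 : ∀ᶠ s in (U : Filter ℝ), τ s ∈ Icc t (t + ρ)))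
    replace hτ : Tendsto τ U (𝓝 r) := hτ
    obtain ⟨L1, hL1⟩ := hlim t
    obtain ⟨L2, hL2⟩ := hlim (t + ρ)
    have hL : L1 = L2 := h.lim_eq (v := fun t => V (x t, σ t)) (A := univ)
      (by simpa using hanti) (by simp) (by simp) hL1 hL2
    have hrat := (hL1.sub hL2).div_const ρ
    rw [hL, sub_self, zero_div] at hrat
    have hrdom : (xs r, γ) ∈ domf := by
      have := h.xsdom r
      rwa [h.reg_const hr ⟨by linarith [hrI.1], by linarith [hrI.2]⟩, hst] at this
    have hWl : Tendsto (fun s => W (x (s + τ s), σ (s + t))) U (𝓝 (W (xs r, γ))) := by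
      refine (hWc (xs r, γ) ⟨hrdom, hBO (h.xsB r), trivial⟩).tendsto.comp
        (tendsto_nhdsWithin_iff.2 ⟨(h.limx' hτ).prodMk_nhds (hst ▸ h.lims t), ?_⟩)
      filter_upwards [hdev] with s hs
      obtain ⟨c1, c2, _⟩ := hs (τ s) ⟨by linarith [(hτ1 s).1], by linarith [(hτ1 s).2]⟩
      have := hOs s (τ s) c1 c2
      exact ⟨this.2, this.1, trivial⟩
    have hle : W (xs r, γ) ≤ 0 := le_of_tendsto_of_tendsto hWl hrat (by
      filter_upwards [hdev] with s hs
      exact hτ2 s hs)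
    have hgt := hball (y := r) (by
      rw [Real.dist_eq, abs_lt]; constructor <;> linarith [hrI.1, hrI.2])
    linarith
  have h2 : EqOn (fun t => W (xs t, γ)) (fun _ => 0) (closure (Ioo a b)) := by
    refine EqOn.of_subset_closure (s := Ioo a b) (t := closure (Ioo a b)) hint ?_
      continuousOn_const subset_closure subset_rfl
    rwa [closure_Ioo hs.1.ne]
  rwa [closure_Ioo hs.1.ne] at h2

end Lim

theorem convergence_to_equilibrium
    {n : ℕ} {Γ : Type*} [MetricSpace Γ] [CompactSpace Γ]
    (f : Eucl n × Γ → Eucl n) (domf : Set (Eucl n × Γ))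
    (hdomf : IsClosed domf) (hf : ContinuousOn f domf)
    (hE0 : AssumpE0 f domf) (hU : AssumpU f domf)
    (x : ℝ → Eucl n) (σ : ℝ → Γ) (Ix : Set ℝ)
    (htraj : IsTrajectory f domf x σ Ix) (hfc : Set.Ici (0 : ℝ) ⊆ Ix)
    (hσ : σ ∈ SAall Γ)
    (V : Eucl n × Γ → ℝ) (domV : Set (Eucl n × Γ)) (W : Eucl n × Γ → ℝ) :
    (AssumptionA4 f domf V domV W x σ Ix → (0 : Eucl n) ∈ Oset domV →
      CondA f domf domV W → CondB f domf domV W →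
      Filter.Tendsto x Filter.atTop (nhds 0)) ∧
    (Finite Γ → (AssumptionA2 domf V domV x σ Ix ∧ Wineq f V W domV domf) →
      (0 : Eucl n) ∈ Oset domV →
      CondA f domf domV W → CondB f domf domV W →
      Filter.Tendsto x Filter.atTop (nhds 0)) ∧
    ((AssumptionA1 domf V domV x σ Ix ∧ Wineq f V W domV domf) →
      (0 : Eucl n) ∈ Oset domV →
      CondA f domf domV W → CondB' f V domf domV W →
      Filter.Tendsto x Filter.atTop (nhds 0)) := by
  have hprod : ∀ {B : Set (Eucl n)}, IsCompact B →
      IsCompact (domf ∩ (B ×ˢ (Set.univ : Set Γ))) := fun hB =>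
    (hB.prod isCompact_univ).inter_left hdomf
  refine ⟨?_, ?_, ?_⟩
  · intro hA4 _ hA hB
    by_contra hx
    obtain ⟨B, hBO, hBc, hxB⟩ := hA4.precompact
    obtain ⟨U, xs, ss, h, hne⟩ := exists_limData hdomf hf htraj hfc hBc hxB hx
    obtain ⟨M, hM⟩ := hA4.boundedV (domf ∩ (B ×ˢ (Set.univ : Set Γ)))
      (fun p hp => ⟨hp.1, hBO hp.2.1, trivial⟩) (hprod hBc)
    refine hne (h.finish hσ hE0 hU hBO hA (fun _ _ => True) (fun γ a b hs t ht => ⟨?_, trivial⟩)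
      (fun γ γ' hg ξ h1 h2 _ _ => hB γ γ' hg ⟨h1, h2⟩))
    exact h.W_zero_A4 hBO hA4.classV hA4.wineq hA4.contW
      (fun t ht => hM _ ⟨h.mem t ht, h.memB t ht, trivial⟩) hA4.nonincr hs t ht
  · intro hfin hA2 _ hA hB
    by_contra hx
    obtain ⟨hA2, hW⟩ := hA2
    obtain ⟨B, hBO, hBc, hxB⟩ := hA2.precompact
    obtain ⟨U, xs, ss, h, hne⟩ := exists_limData hdomf hf htraj hfc hBc hxB hx
    refine hne (h.finish hσ hE0 hU hBO hA (fun _ _ => True) (fun γ a b hs t ht => ⟨?_, trivial⟩)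
      (fun γ γ' hg ξ h1 h2 _ _ => hB γ γ' hg ⟨h1, h2⟩))
    have hev : ∀ r ∈ Set.Ioo a b, ∀ᶠ s in (U : Filter ℝ), σ (s + r) = γ := by
      intro r hr
      have h1 := h.lims r
      rw [(hs.2 r hr).2] at h1
      exact h1 (isOpen_discrete ({γ} : Set Γ) |>.mem_nhds rfl)
    have hl : ∀ r ∈ Set.Ioo a b, Filter.Tendsto (fun s => V (x (s + r), σ (s + r))) U
        (nhds (V (xs r, γ))) := by
      intro r hr
      have h1 : Filter.Tendsto (fun s => V (x (s + r), γ)) U (nhds (V (xs r, γ))) :=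
        (hA2.classV.diff γ (xs r) ⟨hBO (h.xsB r),
          h.seg_dom hs r (Set.Ioo_subset_Icc_self hr)⟩).continuousAt.tendsto.comp (h.limx r)
      refine h1.congr' ?_
      filter_upwards [hev r hr] with s hs'
      rw [hs']
    have hm : (a + b) / 2 ∈ Set.Ioo a b := ⟨by linarith [hs.1], by linarith [hs.1]⟩
    refine (h.W_zero_of_const hBO hA2.classV hW hs (c := V (xs ((a + b) / 2), γ))
      (fun r hr => ?_) t ht).1
    exact h.lim_eq (hA2.nonincr γ) (hev r hr) (hev _ hm) (hl r hr) (hl _ hm)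
  · intro hA1 _ hA hB
    by_contra hx
    obtain ⟨hA1, hW⟩ := hA1
    obtain ⟨B, hBO, hBc, hxB⟩ := hA1.precompact
    obtain ⟨U, xs, ss, h, hne⟩ := exists_limData hdomf hf htraj hfc hBc hxB hx
    have hl : ∀ r, Filter.Tendsto (fun s => V (x (s + r), σ (s + r))) U
        (nhds (V (xs r, ss r))) := by
      intro r
      refine (hA1.contV (xs r, ss r) ⟨h.xsdom r, hBO (h.xsB r), trivial⟩).tendsto.comp
        (tendsto_nhdsWithin_iff.2 ⟨(h.limx r).prodMk_nhds (h.lims r), ?_⟩)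
      filter_upwards [h.ge (-r)] with s hs
      exact ⟨h.mem _ (by linarith), hBO (h.memB _ (by linarith)), trivial⟩
    refine hne (h.finish hσ hE0 hU hBO hA (fun ξ γ => V (ξ, γ) = V (xs 0, ss 0))
      (fun γ a b hs t ht => ?_)
      (fun γ γ' hg ξ h1 h2 h3 h4 => hB γ γ' hg (V (xs 0, ss 0)) ⟨⟨⟨h1, h2⟩, h3⟩, h4⟩))
    refine h.W_zero_of_const hBO hA1.classV hW hs (fun r hr => ?_) t ht
    rw [← (hs.2 r hr).2]
    exact h.lim_eq (v := fun t => V (x t, σ t)) (A := Set.univ)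
      (by simpa using hA1.nonincr) (by simp) (by simp) (hl r) (hl 0)
end
end
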